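/- With n = n_k = 2^k k, for 1 ≤ j ≤ 2k−1 let A_j denote the expected number of ordered pairs (C¹, C²) of configurations counted by X̃(k,k) (each configuration consisting of an unordered pair of disjoint k-cliques with no edges between them together with a distinguished outside common neighbor, such that every vertex outside the two cliques has a neighbor in each of them) whose clique-unions share exactly j vertices, i.e. |(X₁¹ ∪ X₂¹) ∩ (X₁² ∪ X₂²)| = j. Then Σ_{j=1}^{2k−1} A_j = o( (E X̃(k,k))² ) as k → ∞. -/

import Mathlib

open Filter Real

/-- A "configuration" in a graph `G`: two disjoint nonempty cliques `X₁, X₂` with no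
edges between them, together with a vertex `x` outside both that is adjacent to every
vertex of `X₁ ∪ X₂`, such that every vertex outside `X₁ ∪ X₂` has a neighbor in `X₁`
and a neighbor in `X₂`. -/
def IsConfig {n : ℕ} (G : SimpleGraph (Fin n)) (X₁ X₂ : Finset (Fin n)) (x : Fin n) : Prop :=
  X₁.Nonempty ∧ X₂.Nonempty ∧ Disjoint X₁ X₂ ∧
  x ∉ X₁ ∧ x ∉ X₂ ∧
  (∀ u ∈ X₁, ∀ v ∈ X₁, u ≠ v → G.Adj u v) ∧
  (∀ u ∈ X₂, ∀ v ∈ X₂, u ≠ v → G.Adj u v) ∧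
  (∀ u ∈ X₁, ∀ v ∈ X₂, ¬ G.Adj u v) ∧
  (∀ u ∈ X₁, G.Adj x u) ∧ (∀ u ∈ X₂, G.Adj x u) ∧
  (∀ y : Fin n, y ∉ X₁ → y ∉ X₂ →
    (∃ u ∈ X₁, G.Adj y u) ∧ (∃ u ∈ X₂, G.Adj y u))

/-- Property `P` of a graph: existence of a configuration. -/
def PropertyP {n : ℕ} (G : SimpleGraph (Fin n)) : Prop :=
  ∃ (X₁ X₂ : Finset (Fin n)) (x : Fin n), IsConfig G X₁ X₂ x

/-- The probability, under the uniform distribution on graphs on `{1, …, n}`,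
of the set of graphs satisfying `Q`. -/
noncomputable def unifProb (n : ℕ) (Q : SimpleGraph (Fin n) → Prop) : ℝ :=
  (Nat.card {G : SimpleGraph (Fin n) // Q G} : ℝ) / 2 ^ (n.choose 2)

/-- `Xcount n k l G` is the number of ordered triples `(X₁, X₂, x)` forming a
configuration in `G` with `|X₁| = k` and `|X₂| = l`. -/
noncomputable def Xcount (n k l : ℕ) (G : SimpleGraph (Fin n)) : ℕ :=
  Nat.card {t : Finset (Fin n) × Finset (Fin n) × Fin n //
    t.1.card = k ∧ t.2.1.card = l ∧ IsConfig G t.1 t.2.1 t.2.2}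

/-- The expectation of a random variable `Y` under the uniform distribution on graphs
on `{1, …, n}`. -/
noncomputable def expect (n : ℕ) (Y : SimpleGraph (Fin n) → ℝ) : ℝ :=
  (∑ G : SimpleGraph (Fin n), Y G) / 2 ^ (n.choose 2)

/-- `PairCount n k j G` is the number of ordered pairs of (ordered) configurations
`((X₁¹, X₂¹, x¹), (X₁², X₂², x²))` of clique sizes `(k, k)` in `G` whose clique-unions
share exactly `j` vertices. Dividing by `4` counts ordered pairs of configurations with
unordered pairs of cliques, i.e. the pairs counted by `X̃(k,k)`. -/
noncomputable def PairCount (n k j : ℕ) (G : SimpleGraph (Fin n)) : ℕ :=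
  Nat.card {q : (Finset (Fin n) × Finset (Fin n) × Fin n) ×
      (Finset (Fin n) × Finset (Fin n) × Fin n) //
    (q.1.1.card = k ∧ q.1.2.1.card = k ∧ IsConfig G q.1.1 q.1.2.1 q.1.2.2) ∧
    (q.2.1.card = k ∧ q.2.2.1.card = k ∧ IsConfig G q.2.1 q.2.2.1 q.2.2.2) ∧
    ((q.1.1 ∪ q.1.2.1) ∩ (q.2.1 ∪ q.2.2.1)).card = j}

/-- `A n k j` is the expected number of ordered pairs of configurations counted by
`X̃(k,k)` (cliques unordered within each configuration) whose clique-unions share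
exactly `j` vertices. -/
noncomputable def A (n k j : ℕ) : ℝ :=
  expect n (fun G => (PairCount n k j G : ℝ)) / 4

/-! ### Expectation over uniform random graphs -/

theorem card_simpleGraph_fin (n : ℕ) :
    Fintype.card (SimpleGraph (Fin n)) = 2 ^ n.choose 2 := by
  classical
  have e : SimpleGraph (Fin n) ≃ Set {e : Sym2 (Fin n) // ¬ e.IsDiag} :=
    { toFun := fun G => {e | (e : Sym2 (Fin n)) ∈ G.edgeSet}
      invFun := fun s => SimpleGraph.fromEdgeSet (Subtype.val '' s)
      left_inv := by
        intro G
        rw [← SimpleGraph.edgeSet_inj, SimpleGraph.edgeSet_fromEdgeSet]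
        ext e
        have := fun h : e ∈ G.edgeSet => G.not_isDiag_of_mem_edgeSet h
        simp
        tauto
      right_inv := by
        intro s
        ext ⟨e, he⟩
        simp [SimpleGraph.edgeSet_fromEdgeSet, he] }
  rw [Fintype.card_congr e, Fintype.card_set, Sym2.card_subtype_not_diag, Fintype.card_fin]

theorem expect_one (n : ℕ) : expect n (fun _ => 1) = 1 := by
  simp [expect, card_simpleGraph_fin]

theorem expect_mono {n : ℕ} {f g : SimpleGraph (Fin n) → ℝ} (h : ∀ G, f G ≤ g G) :
    expect n f ≤ expect n g := by
  unfold expect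
  gcongr
  exact h _

theorem expect_nonneg {n : ℕ} {f : SimpleGraph (Fin n) → ℝ} (h : ∀ G, 0 ≤ f G) :
    0 ≤ expect n f :=
  div_nonneg (Finset.sum_nonneg fun G _ => h G) (by positivity)

theorem expect_add {n : ℕ} (f g : SimpleGraph (Fin n) → ℝ) :
    expect n (fun G => f G + g G) = expect n f + expect n g := by
  simp [expect, Finset.sum_add_distrib, add_div]

theorem expect_sub {n : ℕ} (f g : SimpleGraph (Fin n) → ℝ) :
    expect n (fun G => f G - g G) = expect n f - expect n g := by
  simp [expect, Finset.sum_sub_distrib, sub_div]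

theorem expect_div_const {n : ℕ} (f : SimpleGraph (Fin n) → ℝ) (c : ℝ) :
    expect n (fun G => f G / c) = expect n f / c := by
  simp only [expect, ← Finset.sum_div]
  exact div_right_comm _ _ _

theorem expect_sum {n : ℕ} {ι : Type*} (s : Finset ι) (f : ι → SimpleGraph (Fin n) → ℝ) :
    expect n (fun G => ∑ i ∈ s, f i G) = ∑ i ∈ s, expect n (f i) := by
  simp only [expect, ← Finset.sum_div]
  rw [Finset.sum_comm]

/-- `f G` is determined by which of the pairs in `S` are edges of `G`. -/
def DependsOnPairs {n : ℕ} (f : SimpleGraph (Fin n) → ℝ) (S : Set (Sym2 (Fin n))) : Prop :=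
  ∀ G H : SimpleGraph (Fin n), (∀ e ∈ S, e ∈ G.edgeSet ↔ e ∈ H.edgeSet) → f G = f H

/-- The graph that agrees with `G` on the pairs in `S` and with `H` elsewhere. -/
def mixGraph {n : ℕ} (S : Set (Sym2 (Fin n))) (G H : SimpleGraph (Fin n)) :
    SimpleGraph (Fin n) :=
  SimpleGraph.fromEdgeSet ((G.edgeSet ∩ S) ∪ (H.edgeSet \ S))

theorem mem_edgeSet_mixGraph {n : ℕ} (S : Set (Sym2 (Fin n))) (G H : SimpleGraph (Fin n))
    (e : Sym2 (Fin n)) :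
    e ∈ (mixGraph S G H).edgeSet ↔ (e ∈ G.edgeSet ∧ e ∈ S) ∨ (e ∈ H.edgeSet ∧ e ∉ S) := by
  have h1 := fun h : e ∈ G.edgeSet => G.not_isDiag_of_mem_edgeSet h
  have h2 := fun h : e ∈ H.edgeSet => H.not_isDiag_of_mem_edgeSet h
  simp only [mixGraph, SimpleGraph.edgeSet_fromEdgeSet, Set.mem_sdiff, Set.mem_union,
    Set.mem_inter_iff, Sym2.mem_diagSet]
  tauto

theorem mixGraph_involutive {n : ℕ} (S : Set (Sym2 (Fin n))) :
    Function.Involutive fun p : SimpleGraph (Fin n) × SimpleGraph (Fin n) =>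
      (mixGraph S p.1 p.2, mixGraph S p.2 p.1) := by
  rintro ⟨G, H⟩
  ext1 <;> rw [← SimpleGraph.edgeSet_inj] <;> ext e <;> simp only [mem_edgeSet_mixGraph] <;> tauto

theorem expect_mul_of_disjoint {n : ℕ} {f g : SimpleGraph (Fin n) → ℝ}
    {S T : Set (Sym2 (Fin n))} (hf : DependsOnPairs f S) (hg : DependsOnPairs g T)
    (hST : Disjoint S T) :
    expect n (fun G => f G * g G) = expect n f * expect n g := by
  have key : (∑ G, f G) * ∑ G, g G = 2 ^ n.choose 2 * ∑ G, f G * g G := by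
    rw [Finset.sum_mul_sum, ← Fintype.sum_prod_type']
    have h1 : ∀ p : SimpleGraph (Fin n) × SimpleGraph (Fin n), f p.1 * g p.2 =
        (fun p : SimpleGraph (Fin n) × SimpleGraph (Fin n) => f p.1 * g p.1)
          ((mixGraph_involutive S).toPerm _ p) := by
      rintro ⟨G, H⟩
      simp only [Function.Involutive.coe_toPerm]
      congr 1
      · apply hf
        intro e he
        rw [mem_edgeSet_mixGraph]
        tauto
      · apply hg
        intro e he
        have : e ∉ S := fun h => Set.disjoint_left.1 hST h he
        rw [mem_edgeSet_mixGraph]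
        tauto
    rw [Fintype.sum_congr _ _ h1, Equiv.sum_comp _ (fun p : SimpleGraph (Fin n) ×
      SimpleGraph (Fin n) => f p.1 * g p.1), Fintype.sum_prod_type]
    simp [Finset.mul_sum, card_simpleGraph_fin]
  have h2 : (2 : ℝ) ^ n.choose 2 ≠ 0 := by positivity
  unfold expect
  rw [div_mul_div_comm, key]
  field_simp

theorem dependsOnPairs_prod {n : ℕ} {ι : Type*} (s : Finset ι)
    (f : ι → SimpleGraph (Fin n) → ℝ) (S : ι → Set (Sym2 (Fin n)))
    (hf : ∀ i ∈ s, DependsOnPairs (f i) (S i)) :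
    DependsOnPairs (fun G => ∏ i ∈ s, f i G) (⋃ i ∈ s, S i) := by
  intro G H h
  refine Finset.prod_congr rfl fun i hi => hf i hi G H fun e he => h e ?_
  exact Set.mem_biUnion hi he

theorem expect_prod_of_disjoint {n : ℕ} {ι : Type*} (s : Finset ι)
    (f : ι → SimpleGraph (Fin n) → ℝ) (S : ι → Set (Sym2 (Fin n)))
    (hf : ∀ i ∈ s, DependsOnPairs (f i) (S i))
    (hS : ∀ i ∈ s, ∀ j ∈ s, i ≠ j → Disjoint (S i) (S j)) :
    expect n (fun G => ∏ i ∈ s, f i G) = ∏ i ∈ s, expect n (f i) := by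
  classical
  induction s using Finset.induction_on with
  | empty => simpa using expect_one n
  | insert a s ha ih =>
    simp only [Finset.prod_insert ha]
    rw [expect_mul_of_disjoint (hf a (by simp))
      (dependsOnPairs_prod s f S fun i hi => hf i (by simp [hi])),
      ih (fun i hi => hf i (by simp [hi]))
        fun i hi j hj => hS i (by simp [hi]) j (by simp [hj])]
    rw [Set.disjoint_iUnion₂_right]
    intro i hi
    exact hS a (by simp) i (by simp [hi]) (by rintro rfl; exact ha hi)

open Classical in
/-- The indicator of the event that `G` and `G₀` agree on the pairs in `F`. -/
noncomputable def agreeInd {n : ℕ} (F : Finset (Sym2 (Fin n))) (G₀ G : SimpleGraph (Fin n)) : ℝ :=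
  if ∀ e ∈ F, (e ∈ G.edgeSet ↔ e ∈ G₀.edgeSet) then 1 else 0

theorem agreeInd_nonneg {n : ℕ} (F : Finset (Sym2 (Fin n))) (G₀ G : SimpleGraph (Fin n)) :
    0 ≤ agreeInd F G₀ G := by
  unfold agreeInd
  split_ifs <;> norm_num

theorem dependsOnPairs_agreeInd {n : ℕ} (F : Finset (Sym2 (Fin n))) (G₀ : SimpleGraph (Fin n)) :
    DependsOnPairs (agreeInd F G₀) F := by
  intro G H h
  unfold agreeInd
  congr 1
  refine propext (forall₂_congr fun e he => ?_)
  rw [h e he]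

theorem expect_agreeInd_singleton {n : ℕ} (e : Sym2 (Fin n)) (he : ¬ e.IsDiag)
    (G₀ : SimpleGraph (Fin n)) : expect n (agreeInd {e} G₀) = 1 / 2 := by
  let τ : SimpleGraph (Fin n) → SimpleGraph (Fin n) := fun G => mixGraph {e} Gᶜ G
  have hmem : ∀ G e', e' ∈ (τ G).edgeSet ↔
      (e' = e ∧ e ∉ G.edgeSet) ∨ (e' ≠ e ∧ e' ∈ G.edgeSet) := by
    intro G e'
    have hc : e ∈ Gᶜ.edgeSet ↔ e ∉ G.edgeSet := by
      induction e with
      | h u v =>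
        simp only [Sym2.mk_isDiag_iff] at he
        simp [he]
    simp only [τ, mem_edgeSet_mixGraph, Set.mem_singleton_iff]
    constructor
    · rintro (⟨h, rfl⟩ | ⟨h, h'⟩) <;> tauto
    · rintro (⟨rfl, h⟩ | ⟨h, h'⟩) <;> tauto
  have hτ : Function.Involutive τ := by
    intro G
    rw [← SimpleGraph.edgeSet_inj]
    ext e'
    rw [hmem, hmem, hmem]
    by_cases h : e' = e
    · subst h; tauto
    · tauto
  have hsum : ∑ G, agreeInd {e} G₀ G = ∑ G, agreeInd {e} G₀ (τ G) :=
    (Equiv.sum_comp (hτ.toPerm τ) (agreeInd {e} G₀)).symm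
  have hadd : ∀ G, agreeInd {e} G₀ G + agreeInd {e} G₀ (τ G) = 1 := by
    intro G
    have he' : e ∈ (τ G).edgeSet ↔ e ∉ G.edgeSet := by simp [hmem]
    simp only [agreeInd, Finset.mem_singleton, forall_eq]
    by_cases h1 : e ∈ G.edgeSet <;> by_cases h2 : e ∈ G₀.edgeSet <;> simp [h1, h2, he']
  have h1 : expect n (agreeInd {e} G₀) + expect n (agreeInd {e} G₀) = 1 := by
    rw [← expect_one n, ← funext hadd, expect_add]
    simp only [expect, ← hsum]
  linarith

theorem expect_agreeInd {n : ℕ} (F : Finset (Sym2 (Fin n))) (hF : ∀ e ∈ F, ¬ e.IsDiag)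
    (G₀ : SimpleGraph (Fin n)) : expect n (agreeInd F G₀) = (1 / 2) ^ F.card := by
  have h : agreeInd F G₀ = fun G => ∏ e ∈ F, agreeInd {e} G₀ G := by
    ext G
    classical
    simp only [agreeInd, Finset.mem_singleton, forall_eq]
    rw [Finset.prod_ite_zero]
    simp
  rw [h, expect_prod_of_disjoint F _ (fun e => (({e} : Finset (Sym2 (Fin n))) : Set _))
    (fun e _ => dependsOnPairs_agreeInd _ _)
    (fun e _ e' _ hne => by simpa using hne),
    Finset.prod_congr rfl fun e he => expect_agreeInd_singleton e (hF e he) G₀]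
  simp

/-! ### Prescribed pairs and domination -/

/-- The unordered pairs of distinct vertices of `V`. -/
def pairsIn {n : ℕ} (V : Finset (Fin n)) : Finset (Sym2 (Fin n)) :=
  V.sym2.filter fun e => ¬ e.IsDiag

theorem mem_pairsIn {n : ℕ} {V : Finset (Fin n)} {u v : Fin n} :
    s(u, v) ∈ pairsIn V ↔ u ∈ V ∧ v ∈ V ∧ u ≠ v := by
  simp [pairsIn, and_assoc]

theorem card_pairsIn {n : ℕ} (V : Finset (Fin n)) : (pairsIn V).card = V.card.choose 2 := by
  rw [← Sym2.card_image_offDiag]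
  congr 1
  ext e
  induction e with
  | h u v =>
    rw [mem_pairsIn]
    simp only [Finset.mem_image, Finset.mem_offDiag, Prod.exists, Function.uncurry_apply_pair]
    constructor
    · exact fun h => ⟨u, v, h, rfl⟩
    · rintro ⟨a, b, ⟨ha, hb, hab⟩, h⟩
      rcases Sym2.eq_iff.1 h with ⟨rfl, rfl⟩ | ⟨rfl, rfl⟩
      · exact ⟨ha, hb, hab⟩
      · exact ⟨hb, ha, hab.symm⟩

theorem pairsIn_inter {n : ℕ} (V W : Finset (Fin n)) :
    pairsIn V ∩ pairsIn W = pairsIn (V ∩ W) := by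
  ext e
  induction e with
  | h u v =>
    simp only [Finset.mem_inter, mem_pairsIn]
    tauto

theorem pairsIn_mono {n : ℕ} {V W : Finset (Fin n)} (h : V ⊆ W) : pairsIn V ⊆ pairsIn W := by
  intro e
  induction e with
  | h u v =>
    simp only [mem_pairsIn]
    exact fun ⟨hu, hv, huv⟩ => ⟨h hu, h hv, huv⟩

theorem not_isDiag_of_mem_pairsIn {n : ℕ} {V : Finset (Fin n)} {e : Sym2 (Fin n)}
    (he : e ∈ pairsIn V) : ¬ e.IsDiag :=
  (Finset.mem_filter.1 he).2

/-- The pairs joining `y` to `A`. -/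
def pairsTo {n : ℕ} (y : Fin n) (A : Finset (Fin n)) : Finset (Sym2 (Fin n)) :=
  A.image fun u => s(y, u)

theorem mem_pairsTo {n : ℕ} {y : Fin n} {A : Finset (Fin n)} {e : Sym2 (Fin n)} :
    e ∈ pairsTo y A ↔ ∃ u ∈ A, s(y, u) = e := by
  simp [pairsTo]

open Classical in
/-- The indicator of the event that `y` has a neighbor in each member of `𝒜`. -/
noncomputable def hitInd {n : ℕ} (𝒜 : List (Finset (Fin n))) (y : Fin n)
    (G : SimpleGraph (Fin n)) : ℝ :=
  if ∀ A ∈ 𝒜, ∃ u ∈ A, G.Adj y u then 1 else 0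

theorem hitInd_nonneg {n : ℕ} (𝒜 : List (Finset (Fin n))) (y : Fin n)
    (G : SimpleGraph (Fin n)) : 0 ≤ hitInd 𝒜 y G := by
  unfold hitInd
  split_ifs <;> norm_num

theorem dependsOnPairs_hitInd {n : ℕ} (𝒜 : List (Finset (Fin n))) (y : Fin n)
    {W : Finset (Fin n)} (h𝒜 : ∀ A ∈ 𝒜, A ⊆ W) : DependsOnPairs (hitInd 𝒜 y) (pairsTo y W) := by
  intro G H h
  unfold hitInd
  congr 1
  refine propext (forall₂_congr fun A hA => exists_congr fun u => and_congr_right fun hu => ?_)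
  exact h s(y, u) (mem_pairsTo.2 ⟨u, h𝒜 A hA hu, rfl⟩)

theorem expect_agreeInd_mul_prod_hitInd {n : ℕ} (F : Finset (Sym2 (Fin n)))
    (G₀ : SimpleGraph (Fin n)) (W : Finset (Fin n)) (𝒜 : List (Finset (Fin n)))
    (hF : F ⊆ pairsIn W) (h𝒜 : ∀ A ∈ 𝒜, A ⊆ W) :
    expect n (fun G => agreeInd F G₀ G * ∏ y ∈ Wᶜ, hitInd 𝒜 y G) =
      (1 / 2) ^ F.card * ∏ y ∈ Wᶜ, expect n (hitInd 𝒜 y) := by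
  have hd := fun y (_ : y ∈ Wᶜ) => dependsOnPairs_hitInd 𝒜 y h𝒜
  rw [expect_mul_of_disjoint (dependsOnPairs_agreeInd F G₀) (dependsOnPairs_prod _ _ _ hd),
    expect_prod_of_disjoint _ _ _ hd,
    expect_agreeInd F fun e he => not_isDiag_of_mem_pairsIn (hF he)]
  · intro y hy z hz hyz
    rw [Finset.disjoint_coe, Finset.disjoint_left]
    intro e he he'
    obtain ⟨u, hu, rfl⟩ := mem_pairsTo.1 he
    obtain ⟨v, hv, h⟩ := mem_pairsTo.1 he'
    rcases Sym2.eq_iff.1 h with ⟨h1, -⟩ | ⟨h1, -⟩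
    · exact hyz h1.symm
    · exact Finset.mem_compl.1 hz (h1 ▸ hu)
  · rw [Set.disjoint_iUnion₂_right]
    intro y hy
    rw [Finset.disjoint_coe, Finset.disjoint_left]
    intro e he he'
    obtain ⟨u, hu, rfl⟩ := mem_pairsTo.1 he'
    exact Finset.mem_compl.1 hy (mem_pairsIn.1 (hF he)).1

open Classical in
/-- The indicator of the event that `y` has no neighbor in `A`. -/
noncomputable def missInd {n : ℕ} (A : Finset (Fin n)) (y : Fin n)
    (G : SimpleGraph (Fin n)) : ℝ :=
  if ∀ u ∈ A, ¬ G.Adj y u then 1 else 0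

theorem expect_missInd {n : ℕ} (A : Finset (Fin n)) (y : Fin n) (hy : y ∉ A) :
    expect n (missInd A y) = (1 / 2) ^ A.card := by
  have h : missInd A y = agreeInd (pairsTo y A) ⊥ := by
    ext G
    unfold missInd agreeInd
    congr 1
    simp [pairsTo]
  have hc : (pairsTo y A).card = A.card :=
    Finset.card_image_of_injective _ (Sym2.mkEmbedding y).injective
  rw [h, expect_agreeInd, hc]
  intro e he
  obtain ⟨u, hu, rfl⟩ := mem_pairsTo.1 he
  rintro h
  exact hy (by rw [Sym2.mk_isDiag_iff] at h; exact h ▸ hu)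

theorem missInd_union {n : ℕ} (A B : Finset (Fin n)) (y : Fin n) (G : SimpleGraph (Fin n)) :
    missInd (A ∪ B) y G = missInd A y G * missInd B y G := by
  have h : (∀ u ∈ A ∪ B, ¬ G.Adj y u) ↔ (∀ u ∈ A, ¬ G.Adj y u) ∧ ∀ u ∈ B, ¬ G.Adj y u := by
    simp only [Finset.mem_union, or_imp, forall_and]
  unfold missInd
  rw [ite_zero_mul_ite_zero, one_mul]
  congr 1
  exact propext h

theorem missInd_eq_zero_or_one {n : ℕ} (A : Finset (Fin n)) (y : Fin n)
    (G : SimpleGraph (Fin n)) : missInd A y G = 0 ∨ missInd A y G = 1 := by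
  unfold missInd
  split_ifs <;> simp

theorem hitInd_nil {n : ℕ} (y : Fin n) (G : SimpleGraph (Fin n)) : hitInd [] y G = 1 := by
  simp [hitInd]

theorem hitInd_cons {n : ℕ} (A : Finset (Fin n)) (𝒜 : List (Finset (Fin n))) (y : Fin n)
    (G : SimpleGraph (Fin n)) : hitInd (A :: 𝒜) y G = (1 - missInd A y G) * hitInd 𝒜 y G := by
  by_cases h : ∃ u ∈ A, G.Adj y u
  · have h' : ¬ ∀ u ∈ A, ¬ G.Adj y u := by push Not; exact h
    have h2 : (∀ B ∈ A :: 𝒜, ∃ u ∈ B, G.Adj y u) ↔ ∀ B ∈ 𝒜, ∃ u ∈ B, G.Adj y u := by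
      simp only [List.forall_mem_cons, h, true_and]
    unfold hitInd missInd
    rw [if_neg h', sub_zero, one_mul]
    congr 1
    exact propext h2
  · have h' : ∀ u ∈ A, ¬ G.Adj y u := by push Not at h; exact h
    simp only [hitInd, missInd, List.forall_mem_cons, h, false_and, if_false, if_pos h']
    simp

theorem expect_hitInd_pair {n : ℕ} (A B : Finset (Fin n)) (y : Fin n) (hA : y ∉ A) (hB : y ∉ B) :
    expect n (hitInd [A, B] y) =
      1 - (1 / 2) ^ A.card - (1 / 2) ^ B.card + (1 / 2) ^ (A ∪ B).card := by
  have h : hitInd [A, B] y = fun G =>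
      (1 - missInd A y G - missInd B y G) + missInd (A ∪ B) y G := by
    ext G
    rw [hitInd_cons, hitInd_cons, hitInd_nil, missInd_union]
    ring
  rw [h, expect_add, expect_sub, expect_sub, expect_one, expect_missInd A y hA,
    expect_missInd B y hB, expect_missInd (A ∪ B) y (by simp [hA, hB])]

theorem expect_hitInd_four_le {n : ℕ} (A B C D : Finset (Fin n)) (y : Fin n)
    (hA : y ∉ A) (hB : y ∉ B) (hC : y ∉ C) (hD : y ∉ D) :
    expect n (hitInd [A, B, C, D] y) ≤
      1 - (1 / 2) ^ A.card - (1 / 2) ^ B.card - (1 / 2) ^ C.card - (1 / 2) ^ D.card +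
        (1 / 2) ^ (A ∪ B).card + (1 / 2) ^ (A ∪ C).card + (1 / 2) ^ (A ∪ D).card +
        (1 / 2) ^ (B ∪ C).card + (1 / 2) ^ (B ∪ D).card + (1 / 2) ^ (C ∪ D).card := by
  have h : ∀ G, hitInd [A, B, C, D] y G ≤
      1 - missInd A y G - missInd B y G - missInd C y G - missInd D y G +
        missInd (A ∪ B) y G + missInd (A ∪ C) y G + missInd (A ∪ D) y G +
        missInd (B ∪ C) y G + missInd (B ∪ D) y G + missInd (C ∪ D) y G := by
    intro G
    simp only [hitInd_cons, hitInd_nil, missInd_union]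
    rcases missInd_eq_zero_or_one A y G with a | a <;>
    rcases missInd_eq_zero_or_one B y G with b | b <;>
    rcases missInd_eq_zero_or_one C y G with c | c <;>
    rcases missInd_eq_zero_or_one D y G with d | d <;>
    rw [a, b, c, d] <;> norm_num
  refine (expect_mono h).trans_eq ?_
  simp only [expect_add, expect_sub, expect_one]
  rw [expect_missInd A y hA, expect_missInd B y hB, expect_missInd C y hC, expect_missInd D y hD]
  repeat rw [expect_missInd (_ ∪ _) y (by simp [*])]

theorem expect_hitInd_le_of_subset {n : ℕ} {𝒜 ℬ : List (Finset (Fin n))} (h : ∀ A ∈ 𝒜, A ∈ ℬ)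
    (y : Fin n) : expect n (hitInd ℬ y) ≤ expect n (hitInd 𝒜 y) := by
  refine expect_mono fun G => ?_
  unfold hitInd
  split_ifs with h1 h2
  · rfl
  · exact absurd (fun A hA => h1 A (h A hA)) h2
  · norm_num
  · rfl

/-! ### Configurations -/

/-- The vertices involved in a triple `(X₁, X₂, x)`. -/
def vertexSet {n : ℕ} (c : Finset (Fin n) × Finset (Fin n) × Fin n) : Finset (Fin n) :=
  insert c.2.2 (c.1 ∪ c.2.1)

/-- The triples `(X₁, X₂, x)` with `X₁`, `X₂` disjoint of size `k` and `x` outside both. -/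
def triples (n k : ℕ) : Finset (Finset (Fin n) × Finset (Fin n) × Fin n) :=
  Finset.univ.filter fun c =>
    c.1.card = k ∧ c.2.1.card = k ∧ Disjoint c.1 c.2.1 ∧ c.2.2 ∉ c.1 ∧ c.2.2 ∉ c.2.1

open Classical in
/-- The indicator of the event that a triple is a configuration. -/
noncomputable def configInd {n : ℕ} (c : Finset (Fin n) × Finset (Fin n) × Fin n)
    (G : SimpleGraph (Fin n)) : ℝ :=
  if IsConfig G c.1 c.2.1 c.2.2 then 1 else 0

theorem configInd_nonneg {n : ℕ} (c : Finset (Fin n) × Finset (Fin n) × Fin n)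
    (G : SimpleGraph (Fin n)) : 0 ≤ configInd c G := by
  unfold configInd
  split_ifs <;> norm_num

theorem mem_vertexSet {n : ℕ} {c : Finset (Fin n) × Finset (Fin n) × Fin n} {u : Fin n} :
    u ∈ vertexSet c ↔ u = c.2.2 ∨ u ∈ c.1 ∨ u ∈ c.2.1 := by
  simp [vertexSet]

theorem mem_triples {n k : ℕ} {c : Finset (Fin n) × Finset (Fin n) × Fin n} :
    c ∈ triples n k ↔ c.1.card = k ∧ c.2.1.card = k ∧ Disjoint c.1 c.2.1 ∧
      c.2.2 ∉ c.1 ∧ c.2.2 ∉ c.2.1 := by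
  simp [triples]

theorem card_vertexSet_inter {n k : ℕ} {c : Finset (Fin n) × Finset (Fin n) × Fin n}
    (hc : c ∈ triples n k) (V : Finset (Fin n)) :
    (V ∩ vertexSet c).card =
      (c.1 ∩ V).card + (c.2.1 ∩ V).card + if c.2.2 ∈ V then 1 else 0 := by
  obtain ⟨-, -, hd, h1, h2⟩ := mem_triples.1 hc
  rw [← Finset.card_union_of_disjoint (hd.mono Finset.inter_subset_left Finset.inter_subset_left),
    ← Finset.union_inter_distrib_right, Finset.inter_comm, vertexSet]
  split_ifs with h
  · rw [Finset.insert_inter_of_mem h, Finset.card_insert_of_notMem (by simp [h1, h2])]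
  · rw [Finset.insert_inter_of_notMem h, add_zero]

theorem card_vertexSet {n k : ℕ} {c : Finset (Fin n) × Finset (Fin n) × Fin n}
    (hc : c ∈ triples n k) : (vertexSet c).card = 2 * k + 1 := by
  obtain ⟨h1, h2, -⟩ := mem_triples.1 hc
  have := card_vertexSet_inter hc Finset.univ
  simp only [Finset.univ_inter, Finset.inter_univ, Finset.mem_univ, if_true, h1, h2] at this
  omega

theorem IsConfig.adj_iff {n : ℕ} {G : SimpleGraph (Fin n)}
    {c : Finset (Fin n) × Finset (Fin n) × Fin n} (h : IsConfig G c.1 c.2.1 c.2.2) {u v : Fin n}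
    (hu : u ∈ vertexSet c) (hv : v ∈ vertexSet c) (huv : u ≠ v) :
    G.Adj u v ↔ ¬ ((u ∈ c.1 ∧ v ∈ c.2.1) ∨ (u ∈ c.2.1 ∧ v ∈ c.1)) := by
  obtain ⟨-, -, hd, hx1, hx2, h11, h22, h12, hx1a, hx2a, -⟩ := h
  have hd' : ∀ w ∈ c.1, w ∉ c.2.1 := fun w hw hw' => Finset.disjoint_left.1 hd hw hw'
  rcases mem_vertexSet.1 hu with rfl | hu | hu <;> rcases mem_vertexSet.1 hv with rfl | hv | hv
  · exact absurd rfl huv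
  · simp [hx1, hx2, hx1a v hv]
  · simp [hx1, hx2, hx2a v hv]
  · simp [hx1, hx2, (hx1a u hu).symm]
  · simp [hd' u hu, hd' v hv, h11 u hu v hv huv]
  · simp [hu, hv, h12 u hu v hv]
  · simp [hx1, hx2, (hx2a u hu).symm]
  · simp [hu, hv, G.adj_comm u v, h12 v hv u hu]
  · have h1 : u ∉ c.1 := fun h => hd' u h hu
    have h2 : v ∉ c.1 := fun h => hd' v h hv
    simp [h1, h2, h22 u hu v hv huv]

theorem exists_graph_adj_iff {n : ℕ} (c : Finset (Fin n) × Finset (Fin n) × Fin n) :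
    ∃ G : SimpleGraph (Fin n), ∀ u v, u ≠ v →
      (G.Adj u v ↔ ¬ ((u ∈ c.1 ∧ v ∈ c.2.1) ∨ (u ∈ c.2.1 ∧ v ∈ c.1))) := by
  refine ⟨⟨fun u v => u ≠ v ∧ ¬ ((u ∈ c.1 ∧ v ∈ c.2.1) ∨ (u ∈ c.2.1 ∧ v ∈ c.1)), ?_, ?_⟩, ?_⟩
  · exact ⟨fun u v ⟨huv, h⟩ => ⟨huv.symm, by tauto⟩⟩
  · exact ⟨fun u h => h.1 rfl⟩
  · intro u v huv
    simp [huv]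

theorem isConfig_of_adj_iff {n k : ℕ} {G : SimpleGraph (Fin n)}
    {c : Finset (Fin n) × Finset (Fin n) × Fin n} (hk : 0 < k) (hc : c ∈ triples n k)
    (hG : ∀ u ∈ vertexSet c, ∀ v ∈ vertexSet c, u ≠ v →
      (G.Adj u v ↔ ¬ ((u ∈ c.1 ∧ v ∈ c.2.1) ∨ (u ∈ c.2.1 ∧ v ∈ c.1))))
    (hdom : ∀ y ∉ vertexSet c, (∃ u ∈ c.1, G.Adj y u) ∧ ∃ u ∈ c.2.1, G.Adj y u) :
    IsConfig G c.1 c.2.1 c.2.2 := by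
  obtain ⟨hk1, hk2, hd, hx1, hx2⟩ := mem_triples.1 hc
  have hd' : ∀ w ∈ c.1, w ∉ c.2.1 := fun w hw hw' => Finset.disjoint_left.1 hd hw hw'
  have m1 : ∀ {u}, u ∈ c.1 → u ∈ vertexSet c := fun h => mem_vertexSet.2 (Or.inr (Or.inl h))
  have m2 : ∀ {u}, u ∈ c.2.1 → u ∈ vertexSet c := fun h => mem_vertexSet.2 (Or.inr (Or.inr h))
  have mx : c.2.2 ∈ vertexSet c := mem_vertexSet.2 (Or.inl rfl)
  have n1 : c.1.Nonempty := Finset.card_pos.1 (hk1 ▸ hk)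
  have n2 : c.2.1.Nonempty := Finset.card_pos.1 (hk2 ▸ hk)
  have a1 : ∀ u ∈ c.1, G.Adj c.2.2 u := fun u hu =>
    (hG _ mx _ (m1 hu) fun h => hx1 (h ▸ hu)).2 (by tauto)
  have a2 : ∀ u ∈ c.2.1, G.Adj c.2.2 u := fun u hu =>
    (hG _ mx _ (m2 hu) fun h => hx2 (h ▸ hu)).2 (by tauto)
  refine ⟨n1, n2, hd, hx1, hx2, ?_, ?_, ?_, a1, a2, ?_⟩
  · intro u hu v hv huv
    have := hd' u hu
    have := hd' v hv
    exact (hG u (m1 hu) v (m1 hv) huv).2 (by tauto)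
  · intro u hu v hv huv
    have := fun h => hd' u h hu
    have := fun h => hd' v h hv
    exact (hG u (m2 hu) v (m2 hv) huv).2 (by tauto)
  · intro u hu v hv h
    exact (hG u (m1 hu) v (m2 hv) h.ne).1 h (by tauto)
  · intro y hy1 hy2
    by_cases hy : y = c.2.2
    · subst hy
      obtain ⟨u, hu⟩ := n1
      obtain ⟨v, hv⟩ := n2
      exact ⟨⟨u, hu, a1 u hu⟩, v, hv, a2 v hv⟩
    · exact hdom y fun h => by rcases mem_vertexSet.1 h with h | h | h <;> contradiction

/-- If two triples are configurations in the same graph, then, up to exchanging the two cliques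
of the second, each of its cliques meets the first triple only in the matching clique and the
common neighbor. -/
theorem IsConfig.inter_subset {n : ℕ} {G : SimpleGraph (Fin n)}
    {c d : Finset (Fin n) × Finset (Fin n) × Fin n} (hc : IsConfig G c.1 c.2.1 c.2.2)
    (hd : IsConfig G d.1 d.2.1 d.2.2) :
    (d.1 ∩ vertexSet c ⊆ insert c.2.2 c.1 ∧ d.2.1 ∩ vertexSet c ⊆ insert c.2.2 c.2.1) ∨
      (d.1 ∩ vertexSet c ⊆ insert c.2.2 c.2.1 ∧ d.2.1 ∩ vertexSet c ⊆ insert c.2.2 c.1) := by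
  obtain ⟨-, -, hcd, hx1, hx2, hc11, hc22, hc12, -⟩ := hc
  obtain ⟨-, -, hdd, hy1, hy2, hd11, hd22, hd12, -⟩ := hd
  have nc : ∀ u ∈ c.1, ∀ v ∈ c.2.1, u ≠ v := fun u hu v hv h =>
    Finset.disjoint_left.1 hcd hu (h ▸ hv)
  have nd : ∀ u ∈ d.1, ∀ v ∈ d.2.1, u ≠ v := fun u hu v hv h =>
    Finset.disjoint_left.1 hdd hu (h ▸ hv)
  have e1 : ∀ u ∈ d.1, u ∈ c.1 → ∀ v ∈ d.2.1, v ∉ c.1 := fun u hu hu' v hv hv' =>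
    hd12 u hu v hv (hc11 u hu' v hv' (nd u hu v hv))
  have e2 : ∀ u ∈ d.1, u ∈ c.2.1 → ∀ v ∈ d.2.1, v ∉ c.2.1 := fun u hu hu' v hv hv' =>
    hd12 u hu v hv (hc22 u hu' v hv' (nd u hu v hv))
  have e3 : ∀ u ∈ d.1, u ∈ c.1 → ∀ v ∈ d.1, v ∉ c.2.1 := fun u hu hu' v hv hv' =>
    hc12 u hu' v hv' (hd11 u hu v hv (nc u hu' v hv'))
  have e4 : ∀ u ∈ d.2.1, u ∈ c.1 → ∀ v ∈ d.2.1, v ∉ c.2.1 := fun u hu hu' v hv hv' =>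
    hc12 u hu' v hv' (hd22 u hu v hv (nc u hu' v hv'))
  have sub1 : ∀ s : Finset (Fin n), (∀ u ∈ s, u ∉ c.2.1) →
      s ∩ vertexSet c ⊆ insert c.2.2 c.1 := by
    intro s hs u hu
    rw [Finset.mem_inter, mem_vertexSet] at hu
    have := hs u hu.1
    rw [Finset.mem_insert]
    tauto
  have sub2 : ∀ s : Finset (Fin n), (∀ u ∈ s, u ∉ c.1) →
      s ∩ vertexSet c ⊆ insert c.2.2 c.2.1 := by
    intro s hs u hu
    rw [Finset.mem_inter, mem_vertexSet] at hu
    have := hs u hu.1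
    rw [Finset.mem_insert]
    tauto
  by_cases h1 : ∃ u ∈ d.1, u ∈ c.1
  · obtain ⟨u, hu, hu'⟩ := h1
    exact Or.inl ⟨sub1 _ (e3 u hu hu'), sub2 _ (e1 u hu hu')⟩
  by_cases h2 : ∃ u ∈ d.2.1, u ∈ c.2.1
  · obtain ⟨u, hu, hu'⟩ := h2
    exact Or.inl ⟨sub1 _ fun v hv hv' => e2 v hv hv' u hu hu',
      sub2 _ fun v hv hv' => e4 v hv hv' u hu hu'⟩
  push Not at h1 h2
  exact Or.inr ⟨sub2 _ h1, sub1 _ h2⟩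

theorem IsConfig.vertexSet_ne {n k : ℕ} {G : SimpleGraph (Fin n)}
    {c d : Finset (Fin n) × Finset (Fin n) × Fin n} (hck : c ∈ triples n k)
    (hc : IsConfig G c.1 c.2.1 c.2.2) (hd : IsConfig G d.1 d.2.1 d.2.2)
    (hcd : ((c.1 ∪ c.2.1) ∩ (d.1 ∪ d.2.1)).card < 2 * k) : vertexSet c ≠ vertexSet d := by
  intro h
  obtain ⟨hk1, hk2, hdisj, hx1, hx2⟩ := mem_triples.1 hck
  obtain ⟨⟨u, hu⟩, ⟨v, hv⟩, hdd, hy1, hy2, -, -, hd12, -⟩ := hd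
  have hadj : ∀ w ∈ c.1 ∪ c.2.1, G.Adj c.2.2 w := by
    intro w hw
    rcases Finset.mem_union.1 hw with hw | hw
    · exact hc.2.2.2.2.2.2.2.2.1 w hw
    · exact hc.2.2.2.2.2.2.2.2.2.1 w hw
  have hmem : ∀ w ∈ d.1 ∪ d.2.1, w ≠ c.2.2 → w ∈ c.1 ∪ c.2.1 := by
    intro w hw hne
    have : w ∈ vertexSet c := h ▸ Finset.mem_insert_of_mem hw
    exact (Finset.mem_insert.1 this).resolve_left hne
  by_cases hx : c.2.2 = d.2.2
  · have hU : c.1 ∪ c.2.1 ⊆ d.1 ∪ d.2.1 := by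
      intro w hw
      have : w ∈ vertexSet d := h ▸ Finset.mem_insert_of_mem hw
      refine (Finset.mem_insert.1 this).resolve_left fun hne => ?_
      rw [← hx] at hne
      exact (hadj w hw).ne hne.symm
    rw [Finset.inter_eq_left.2 hU, Finset.card_union_of_disjoint hdisj, hk1, hk2] at hcd
    omega
  · have hxd : c.2.2 ∈ vertexSet d := h ▸ Finset.mem_insert_self _ _
    rcases Finset.mem_union.1 ((Finset.mem_insert.1 hxd).resolve_left hx) with hxd | hxd
    · exact hd12 _ hxd v hv (hadj v (hmem v (Finset.mem_union_right _ hv) fun e =>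
        Finset.disjoint_left.1 hdd hxd (e ▸ hv)))
    · exact hd12 u hu _ hxd (hadj u (hmem u (Finset.mem_union_left _ hu) fun e =>
        Finset.disjoint_left.1 hdd hu (e ▸ hxd))).symm

theorem card_pairsIn_union {n : ℕ} (V W : Finset (Fin n)) :
    (pairsIn V ∪ pairsIn W).card + (V ∩ W).card.choose 2 =
      V.card.choose 2 + W.card.choose 2 := by
  rw [← card_pairsIn, ← card_pairsIn, ← card_pairsIn, ← pairsIn_inter]
  exact Finset.card_union_add_card_inter _ _

theorem expect_configInd_mul_le {n k : ℕ} {c d : Finset (Fin n) × Finset (Fin n) × Fin n}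
    (hc : c ∈ triples n k) (hd : d ∈ triples n k) {q : ℝ} (hq0 : 0 ≤ q)
    (hq : ∀ y ∉ vertexSet c ∪ vertexSet d, expect n (hitInd [c.1, c.2.1, d.1, d.2.1] y) ≤ q) :
    expect n (fun G => configInd c G * configInd d G) ≤
      (1 / 2) ^ (2 * (2 * k + 1).choose 2) *
        2 ^ ((vertexSet c ∩ vertexSet d).card.choose 2) *
        q ^ (vertexSet c ∪ vertexSet d)ᶜ.card := by
  by_cases hG : ∃ G₀ : SimpleGraph (Fin n), IsConfig G₀ c.1 c.2.1 c.2.2 ∧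
      IsConfig G₀ d.1 d.2.1 d.2.2
  · obtain ⟨G₀, hGc, hGd⟩ := hG
    set F := pairsIn (vertexSet c) ∪ pairsIn (vertexSet d) with hF
    set W := vertexSet c ∪ vertexSet d with hW
    have hle : ∀ G, configInd c G * configInd d G ≤
        agreeInd F G₀ G * ∏ y ∈ Wᶜ, hitInd [c.1, c.2.1, d.1, d.2.1] y G := by
      intro G
      by_cases h : IsConfig G c.1 c.2.1 c.2.2 ∧ IsConfig G d.1 d.2.1 d.2.2
      · have h1 : agreeInd F G₀ G = 1 := by
          rw [agreeInd, if_pos]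
          intro e he
          induction e with
          | h u v =>
            rw [hF, Finset.mem_union, mem_pairsIn, mem_pairsIn] at he
            rw [SimpleGraph.mem_edgeSet, SimpleGraph.mem_edgeSet]
            rcases he with ⟨hu, hv, huv⟩ | ⟨hu, hv, huv⟩
            · rw [h.1.adj_iff hu hv huv, hGc.adj_iff hu hv huv]
            · rw [h.2.adj_iff hu hv huv, hGd.adj_iff hu hv huv]
        have h2 : ∀ y ∈ Wᶜ, hitInd [c.1, c.2.1, d.1, d.2.1] y G = 1 := by
          intro y hy
          rw [hW, Finset.mem_compl, Finset.mem_union, mem_vertexSet, mem_vertexSet] at hy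
          push Not at hy
          obtain ⟨⟨-, hy1, hy2⟩, -, hy3, hy4⟩ := hy
          have e1 := h.1.2.2.2.2.2.2.2.2.2.2 y hy1 hy2
          have e2 := h.2.2.2.2.2.2.2.2.2.2.2 y hy3 hy4
          rw [hitInd, if_pos]
          simp only [List.forall_mem_cons, e1.1, e1.2, e2.1, e2.2, true_and]
          simp
        rw [h1, Finset.prod_eq_one h2]
        simp [configInd, h.1, h.2]
      · have h0 : configInd c G * configInd d G = 0 := by
          rw [mul_eq_zero]
          by_contra hne
          push Not at hne
          exact h ⟨by_contra fun h' => hne.1 (by simp [configInd, h']),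
            by_contra fun h' => hne.2 (by simp [configInd, h'])⟩
        rw [h0]
        exact mul_nonneg (agreeInd_nonneg _ _ _)
          (Finset.prod_nonneg fun y _ => hitInd_nonneg _ _ _)
    refine (expect_mono hle).trans ?_
    rw [expect_agreeInd_mul_prod_hitInd]
    · have hcard : F.card + (vertexSet c ∩ vertexSet d).card.choose 2 =
          2 * (2 * k + 1).choose 2 := by
        rw [hF, card_pairsIn_union, card_vertexSet hc, card_vertexSet hd, ← two_mul]
      have hpow : (1 / 2 : ℝ) ^ F.card = (1 / 2) ^ (2 * (2 * k + 1).choose 2) *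
          2 ^ ((vertexSet c ∩ vertexSet d).card.choose 2) := by
        rw [← hcard, pow_add, mul_assoc, ← mul_pow]
        norm_num
      rw [hpow]
      gcongr
      rw [← Finset.prod_const]
      exact Finset.prod_le_prod (fun y _ => expect_nonneg fun G => hitInd_nonneg _ _ _)
        fun y hy => hq y (Finset.mem_compl.1 hy)
    · exact Finset.union_subset (pairsIn_mono Finset.subset_union_left)
        (pairsIn_mono Finset.subset_union_right)
    · have hs : ∀ e : Finset (Fin n) × Finset (Fin n) × Fin n, e.1 ⊆ vertexSet e ∧
          e.2.1 ⊆ vertexSet e := fun e =>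
        ⟨fun u hu => mem_vertexSet.2 (by tauto), fun u hu => mem_vertexSet.2 (by tauto)⟩
      simp only [List.forall_mem_cons, List.not_mem_nil, false_imp_iff, implies_true, and_true]
      exact ⟨(hs c).1.trans Finset.subset_union_left, (hs c).2.trans Finset.subset_union_left,
        (hs d).1.trans Finset.subset_union_right, (hs d).2.trans Finset.subset_union_right⟩
  · have h0 : ∀ G, configInd c G * configInd d G ≤ 0 := by
      intro G
      have h := not_exists.1 hG G
      unfold configInd
      split_ifs <;> simp_all
    refine (expect_mono h0).trans ?_
    simp only [expect, Finset.sum_const_zero, zero_div]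
    positivity

theorem le_expect_configInd {n k : ℕ} (hk : 0 < k)
    {c : Finset (Fin n) × Finset (Fin n) × Fin n} (hc : c ∈ triples n k) :
    (1 / 2) ^ ((2 * k + 1).choose 2) * ((1 - (1 / 2) ^ k) ^ 2) ^ (n - (2 * k + 1)) ≤
      expect n (configInd c) := by
  obtain ⟨hk1, hk2, hd, hx1, hx2⟩ := mem_triples.1 hc
  obtain ⟨G₀, hG₀⟩ := exists_graph_adj_iff c
  have hle : ∀ G, agreeInd (pairsIn (vertexSet c)) G₀ G *
      ∏ y ∈ (vertexSet c)ᶜ, hitInd [c.1, c.2.1] y G ≤ configInd c G := by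
    intro G
    by_cases h1 : ∀ e ∈ pairsIn (vertexSet c), (e ∈ G.edgeSet ↔ e ∈ G₀.edgeSet)
    · by_cases h2 : ∀ y ∈ (vertexSet c)ᶜ, ∀ A ∈ [c.1, c.2.1], ∃ u ∈ A, G.Adj y u
      · have h : IsConfig G c.1 c.2.1 c.2.2 := by
          refine isConfig_of_adj_iff hk hc ?_ ?_
          · intro u hu v hv huv
            rw [← hG₀ u v huv]
            exact h1 s(u, v) (mem_pairsIn.2 ⟨hu, hv, huv⟩)
          · intro y hy
            simpa using h2 y (Finset.mem_compl.2 hy)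
        have h3 : ∏ y ∈ (vertexSet c)ᶜ, hitInd [c.1, c.2.1] y G = 1 :=
          Finset.prod_eq_one fun y hy => by rw [hitInd, if_pos (h2 y hy)]
        rw [h3, agreeInd, if_pos h1, configInd, if_pos h, one_mul]
      · push Not at h2
        obtain ⟨y, hy, A, hA, h2⟩ := h2
        have h3 : hitInd [c.1, c.2.1] y G = 0 := by
          rw [hitInd, if_neg]
          intro h
          obtain ⟨u, hu, huA⟩ := h A hA
          exact h2 u hu huA
        rw [Finset.prod_eq_zero hy h3, mul_zero]
        exact configInd_nonneg _ _
    · rw [agreeInd, if_neg h1, zero_mul]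
      exact configInd_nonneg _ _
  refine le_trans (le_of_eq ?_) (expect_mono hle)
  rw [expect_agreeInd_mul_prod_hitInd _ _ _ _ subset_rfl]
  · rw [card_pairsIn, card_vertexSet hc]
    congr 1
    rw [Finset.prod_congr rfl (g := fun _ => (1 - (1 / 2 : ℝ) ^ k) ^ 2), Finset.prod_const,
      Finset.card_compl, card_vertexSet hc, Fintype.card_fin]
    intro y hy
    rw [Finset.mem_compl, mem_vertexSet] at hy
    push Not at hy
    rw [expect_hitInd_pair _ _ _ hy.2.1 hy.2.2, Finset.card_union_of_disjoint hd, hk1, hk2]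
    ring
  · simp only [List.forall_mem_cons, List.not_mem_nil, false_imp_iff, implies_true, and_true]
    exact ⟨fun u hu => mem_vertexSet.2 (by tauto), fun u hu => mem_vertexSet.2 (by tauto)⟩

/-! ### Estimates for `n = 2 ^ k * k` -/

/-- A bound for the probability that two triples sharing `t` vertices are both dominating. -/
noncomputable def domBound (k t : ℕ) : ℝ :=
  if t ≤ k then exp (-4 * k + 24 + 6 * t) else exp (-2 * k + 13)

theorem domBound_pos (k t : ℕ) : 0 < domBound k t := by
  unfold domBound
  split_ifs <;> positivity

theorem half_pow_mul_two_pow (k : ℕ) : (1 / 2 : ℝ) ^ k * 2 ^ k = 1 := by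
  rw [← mul_pow]
  norm_num

theorem half_pow_sub_mul_le {k t : ℕ} (ht1 : 1 ≤ t) (htk : t ≤ k) :
    (1 / 2 : ℝ) ^ (2 * k - t) * (2 ^ k * k) ≤ t := by
  obtain ⟨i, rfl⟩ := Nat.exists_eq_add_of_le htk
  have e : 2 * (t + i) - t = i + (t + i) := by omega
  have h1 : ((t + i : ℕ) : ℝ) ≤ t * 2 ^ i := by
    have h2 : (i : ℝ) + 1 ≤ 2 ^ i := by exact_mod_cast Nat.lt_two_pow_self
    have h3 : (1 : ℝ) ≤ t := by exact_mod_cast ht1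
    have h4 : (0 : ℝ) ≤ i := by positivity
    push_cast
    nlinarith
  calc (1 / 2 : ℝ) ^ (2 * (t + i) - t) * (2 ^ (t + i) * (t + i : ℕ))
      = (1 / 2) ^ i * ((1 / 2) ^ (t + i) * 2 ^ (t + i)) * (t + i : ℕ) := by rw [e, pow_add]; ring
    _ ≤ (1 / 2) ^ i * 1 * (t * 2 ^ i) := by rw [half_pow_mul_two_pow]; gcongr
    _ = ((1 / 2) ^ i * 2 ^ i) * t := by ring
    _ = t := by rw [half_pow_mul_two_pow, one_mul]

theorem four_mul_add_two_le (k : ℕ) : (4 * k + 2 : ℝ) ≤ 6 * 2 ^ k := by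
  have h2 : (k : ℝ) + 1 ≤ 2 ^ k := by exact_mod_cast Nat.lt_two_pow_self
  linarith

theorem expect_configInd_mul_le_domBound {k : ℕ}
    {c d : Finset (Fin (2 ^ k * k)) × Finset (Fin (2 ^ k * k)) × Fin (2 ^ k * k)}
    (hc : c ∈ triples (2 ^ k * k) k) (hd : d ∈ triples (2 ^ k * k) k)
    (ht1 : 1 ≤ (vertexSet c ∩ vertexSet d).card) :
    expect (2 ^ k * k) (fun G => configInd c G * configInd d G) ≤
      (1 / 2) ^ (2 * (2 * k + 1).choose 2) *
        2 ^ ((vertexSet c ∩ vertexSet d).card.choose 2) *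
        domBound k (vertexSet c ∩ vertexSet d).card := by
  set t := (vertexSet c ∩ vertexSet d).card with ht
  set m := (vertexSet c ∪ vertexSet d)ᶜ.card with hm
  obtain ⟨hc1, hc2, hcd, -⟩ := mem_triples.1 hc
  obtain ⟨hd1, hd2, hdd, -⟩ := mem_triples.1 hd
  have hm1 : (m : ℝ) ≤ 2 ^ k * k := by
    have : m ≤ 2 ^ k * k := (Finset.card_le_univ _).trans_eq (Fintype.card_fin _)
    exact_mod_cast this
  have hm2 : (2 ^ k * k : ℝ) - (4 * k + 2) ≤ m := by
    have h1 := Finset.card_union_le (vertexSet c) (vertexSet d)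
    have h2 := Finset.card_add_card_compl (vertexSet c ∪ vertexSet d)
    rw [card_vertexSet hc, card_vertexSet hd] at h1
    rw [Fintype.card_fin, ← hm] at h2
    have h3 : 2 ^ k * k ≤ m + (4 * k + 2) := by omega
    have h4 : ((2 ^ k * k : ℕ) : ℝ) ≤ ((m + (4 * k + 2) : ℕ) : ℝ) := by exact_mod_cast h3
    push_cast at h4
    linarith
  have hlow : (k : ℝ) - 6 ≤ (1 / 2) ^ k * m := by
    have h1 := mul_le_mul_of_nonneg_left hm2 (by positivity : (0 : ℝ) ≤ (1 / 2) ^ k)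
    have h2 := mul_le_mul_of_nonneg_left (four_mul_add_two_le k)
      (by positivity : (0 : ℝ) ≤ (1 / 2) ^ k)
    have h3 := half_pow_mul_two_pow k
    have e1 : (1 / 2 : ℝ) ^ k * (2 ^ k * k - (4 * k + 2)) =
        ((1 / 2) ^ k * 2 ^ k) * k - (1 / 2) ^ k * (4 * k + 2) := by ring
    have e2 : (1 / 2 : ℝ) ^ k * (6 * 2 ^ k) = 6 * ((1 / 2) ^ k * 2 ^ k) := by ring
    rw [e1, h3] at h1
    rw [e2, h3] at h2
    linarith
  have hmem : ∀ y ∉ vertexSet c ∪ vertexSet d,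
      (y ∉ c.1 ∧ y ∉ c.2.1) ∧ (y ∉ d.1 ∧ y ∉ d.2.1) := by
    intro y hy
    rw [Finset.mem_union, mem_vertexSet, mem_vertexSet] at hy
    tauto
  unfold domBound
  split_ifs with htk
  · refine (expect_configInd_mul_le hc hd
      (q := exp (-4 * (1 / 2) ^ k + 6 * (1 / 2) ^ (2 * k - t))) (exp_pos _).le ?_).trans ?_
    · intro y hy
      obtain ⟨⟨h1, h2⟩, h3, h4⟩ := hmem y hy
      refine (expect_hitInd_four_le _ _ _ _ y h1 h2 h3 h4).trans ?_
      have key : ∀ A B : Finset (Fin (2 ^ k * k)), A.card = k → B.card = k →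
          A ∩ B ⊆ vertexSet c ∩ vertexSet d →
          (1 / 2 : ℝ) ^ (A ∪ B).card ≤ (1 / 2) ^ (2 * k - t) := by
        intro A B hA hB hAB
        refine pow_le_pow_of_le_one (by norm_num) (by norm_num) ?_
        have := Finset.card_union_add_card_inter A B
        have := Finset.card_le_card hAB
        omega
      have key2 : ∀ A B : Finset (Fin (2 ^ k * k)), A ⊆ vertexSet c → B ⊆ vertexSet d →
          A ∩ B ⊆ vertexSet c ∩ vertexSet d := fun A B hA hB => Finset.inter_subset_inter hA hB
      have sc1 : c.1 ⊆ vertexSet c := fun u hu => mem_vertexSet.2 (by tauto)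
      have sc2 : c.2.1 ⊆ vertexSet c := fun u hu => mem_vertexSet.2 (by tauto)
      have sd1 : d.1 ⊆ vertexSet d := fun u hu => mem_vertexSet.2 (by tauto)
      have sd2 : d.2.1 ⊆ vertexSet d := fun u hu => mem_vertexSet.2 (by tauto)
      have i1 := key c.1 c.2.1 hc1 hc2 (by simp [Finset.disjoint_iff_inter_eq_empty.1 hcd])
      have i2 := key c.1 d.1 hc1 hd1 (key2 _ _ sc1 sd1)
      have i3 := key c.1 d.2.1 hc1 hd2 (key2 _ _ sc1 sd2)
      have i4 := key c.2.1 d.1 hc2 hd1 (key2 _ _ sc2 sd1)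
      have i5 := key c.2.1 d.2.1 hc2 hd2 (key2 _ _ sc2 sd2)
      have i6 := key d.1 d.2.1 hd1 hd2 (by simp [Finset.disjoint_iff_inter_eq_empty.1 hdd])
      rw [hc1, hc2, hd1, hd2]
      refine le_trans ?_ (add_one_le_exp _)
      linarith
    · rw [← exp_nat_mul]
      gcongr
      have h1 : (1 / 2 : ℝ) ^ (2 * k - t) * m ≤ t :=
        le_trans (by gcongr) (half_pow_sub_mul_le ht1 htk)
      have e : (m : ℝ) * (-4 * (1 / 2) ^ k + 6 * (1 / 2) ^ (2 * k - t)) =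
          -4 * ((1 / 2) ^ k * m) + 6 * ((1 / 2) ^ (2 * k - t) * m) := by ring
      rw [e]
      linarith
  · refine (expect_configInd_mul_le hc hd
      (q := exp (-2 * (1 / 2) ^ k + (1 / 2) ^ (k + k))) (exp_pos _).le ?_).trans ?_
    · intro y hy
      obtain ⟨⟨h1, h2⟩, -⟩ := hmem y hy
      refine (expect_hitInd_le_of_subset (𝒜 := [c.1, c.2.1]) (by simp) y).trans ?_
      rw [expect_hitInd_pair _ _ y h1 h2, Finset.card_union_of_disjoint hcd, hc1, hc2]
      refine le_trans ?_ (add_one_le_exp _)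
      linarith
    · rw [← exp_nat_mul]
      gcongr
      have h1 : (1 / 2 : ℝ) ^ (k + k) * m ≤ 1 := by
        have h2 : (k : ℝ) ≤ 2 ^ k := by exact_mod_cast Nat.lt_two_pow_self.le
        calc (1 / 2 : ℝ) ^ (k + k) * m ≤ (1 / 2) ^ (k + k) * (2 ^ k * 2 ^ k) := by
              gcongr
              exact hm1.trans (by gcongr)
          _ = ((1 / 2) ^ k * 2 ^ k) * ((1 / 2) ^ k * 2 ^ k) := by rw [pow_add]; ring
          _ = 1 := by rw [half_pow_mul_two_pow, one_mul]
      have e : (m : ℝ) * (-2 * (1 / 2) ^ k + (1 / 2) ^ (k + k)) =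
          -2 * ((1 / 2) ^ k * m) + (1 / 2) ^ (k + k) * m := by ring
      rw [e]
      linarith

theorem exp_le_one_sub_half_pow {k n : ℕ} (hk : 0 < k) (hn : n ≤ 2 ^ k * k) :
    exp (-2 * k - 2) ≤ ((1 - (1 / 2 : ℝ) ^ k) ^ 2) ^ n := by
  have hb : (k : ℝ) + 1 ≤ 2 ^ k := by exact_mod_cast Nat.lt_two_pow_self
  have hk' : (1 : ℝ) ≤ k := by exact_mod_cast hk
  set b : ℝ := 2 ^ k with hbdef
  have hb1 : 0 < b - 1 := by linarith
  have hx : (1 / 2 : ℝ) ^ k = 1 / b := by rw [hbdef, one_div, one_div, inv_pow]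
  have h1 : exp (-(1 / (b - 1))) ≤ 1 - 1 / b := by
    rw [exp_neg]
    have h2 : b / (b - 1) ≤ exp (1 / (b - 1)) := by
      refine le_trans (le_of_eq ?_) (add_one_le_exp _)
      field_simp
      ring
    refine (inv_anti₀ (by positivity) h2).trans (le_of_eq ?_)
    have : b ≠ 0 := by linarith
    field_simp
  have h0 : (0 : ℝ) ≤ (1 - 1 / b) := (exp_pos _).le.trans h1
  have hn' : (n : ℝ) ≤ b * k := by rw [hbdef]; exact_mod_cast hn
  rw [hx]
  calc exp (-2 * k - 2) ≤ exp ((n : ℝ) * ((2 : ℕ) * -(1 / (b - 1)))) := by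
        gcongr
        have h3 : (n : ℝ) * (1 / (b - 1)) ≤ k + 1 := by
          rw [mul_one_div, div_le_iff₀ hb1]
          nlinarith
        push_cast
        linarith
    _ = (exp (-(1 / (b - 1))) ^ 2) ^ n := by rw [exp_nat_mul, exp_nat_mul]
    _ ≤ ((1 - 1 / b) ^ 2) ^ n := by gcongr

/-! ### Counting triples -/

theorem pow_le_factorial_mul_card_triples (n k : ℕ) :
    (n - 2 * k) ^ (2 * k + 1) ≤ k.factorial ^ 2 * (triples n k).card := by
  let T : Finset ((_ : Finset (Fin n)) × (_ : Finset (Fin n)) × Fin n) :=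
    (Finset.powersetCard k Finset.univ).sigma fun X₁ =>
      (Finset.powersetCard k X₁ᶜ).sigma fun X₂ => (X₁ ∪ X₂)ᶜ
  have hT : T.card = n.choose k * ((n - k).choose k * (n - 2 * k)) := by
    rw [Finset.card_sigma, Finset.sum_const_nat (m := (n - k).choose k * (n - 2 * k))]
    · simp
    intro X₁ h₁
    rw [Finset.card_sigma, Finset.sum_const_nat (m := n - 2 * k)]
    · rw [Finset.card_powersetCard, Finset.card_compl, Fintype.card_fin,
        (Finset.mem_powersetCard.1 h₁).2]
    intro X₂ h₂
    rw [Finset.mem_powersetCard] at h₁ h₂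
    rw [Finset.card_compl, Fintype.card_fin, Finset.card_union_of_disjoint
      (Finset.disjoint_left.2 fun u hu hu' => Finset.mem_compl.1 (h₂.1 hu') hu), h₁.2, h₂.2,
      two_mul]
  have hle : T.card ≤ (triples n k).card := by
    refine Finset.card_le_card_of_injOn (fun p => (p.1, p.2.1, p.2.2)) ?_ ?_
    · rintro ⟨X₁, X₂, x⟩ h
      simp only [T, Finset.coe_sigma, Set.mem_sigma_iff, Finset.mem_coe,
        Finset.mem_powersetCard, Finset.mem_compl, Finset.mem_union] at h
      obtain ⟨⟨-, h₁⟩, ⟨hs, h₂⟩, hx⟩ := h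
      refine mem_triples.2 ⟨h₁, h₂, ?_, by tauto, by tauto⟩
      exact Finset.disjoint_left.2 fun u hu hu' => Finset.mem_compl.1 (hs hu') hu
    · rintro ⟨X₁, X₂, x⟩ - ⟨Y₁, Y₂, y⟩ - h
      simp only [Prod.mk.injEq] at h
      obtain ⟨rfl, rfl, rfl⟩ := h
      rfl
  have h1 : (n - 2 * k) ^ k ≤ k.factorial * n.choose k := by
    rw [← Nat.descFactorial_eq_factorial_mul_choose]
    exact (Nat.pow_le_pow_left (by omega) k).trans (Nat.pow_sub_le_descFactorial n k)
  have h2 : (n - 2 * k) ^ k ≤ k.factorial * (n - k).choose k := by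
    rw [← Nat.descFactorial_eq_factorial_mul_choose]
    exact (Nat.pow_le_pow_left (by omega) k).trans (Nat.pow_sub_le_descFactorial (n - k) k)
  calc (n - 2 * k) ^ (2 * k + 1) = (n - 2 * k) ^ k * (n - 2 * k) ^ k * (n - 2 * k) := by ring
    _ ≤ (k.factorial * n.choose k) * (k.factorial * (n - k).choose k) * (n - 2 * k) := by gcongr
    _ = k.factorial ^ 2 * T.card := by rw [hT]; ring
    _ ≤ _ := by gcongr

theorem le_two_mul_card_triples {k : ℕ} (hk : 4 * (2 * k + 1) ≤ 2 ^ k) :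
    ((2 ^ k * k : ℕ) : ℝ) ^ (2 * k + 1) ≤
      2 * ((k.factorial : ℝ) ^ 2 * (triples (2 ^ k * k) k).card) := by
  have hle : 2 * k ≤ 2 ^ k * k := by nlinarith
  have h1 : ((2 ^ k * k : ℕ) - 2 * k : ℝ) ^ (2 * k + 1) ≤
      (k.factorial : ℝ) ^ 2 * (triples (2 ^ k * k) k).card := by
    have := pow_le_factorial_mul_card_triples (2 ^ k * k) k
    have h : (((2 ^ k * k - 2 * k) ^ (2 * k + 1) : ℕ) : ℝ) ≤
      ((k.factorial ^ 2 * (triples (2 ^ k * k) k).card : ℕ) : ℝ) := by exact_mod_cast this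
    rw [Nat.cast_pow, Nat.cast_sub hle] at h
    push_cast at h ⊢
    exact h
  have hk' : (4 * (2 * k + 1) : ℝ) ≤ 2 ^ k := by exact_mod_cast hk
  have hb : (0 : ℝ) < 2 ^ k := by positivity
  have h2 : (1 / 2 : ℝ) ≤ (1 + -(2 / 2 ^ k)) ^ (2 * k + 1) := by
    refine le_trans ?_ (one_add_mul_le_pow ?_ _)
    · push_cast
      have : (2 * k + 1 : ℝ) * (2 / 2 ^ k) ≤ 1 / 2 := by
        rw [mul_div_assoc', div_le_iff₀ hb]
        linarith
      linarith
    · have : (2 : ℝ) / 2 ^ k ≤ 1 := by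
        rw [div_le_one hb]
        have : (0 : ℝ) ≤ k := by positivity
        linarith
      linarith
  have e : ((2 ^ k * k : ℕ) - 2 * k : ℝ) = (2 ^ k * k : ℕ) * (1 + -(2 / 2 ^ k)) := by
    push_cast
    field_simp
    ring
  rw [e, mul_pow] at h1
  have h3 : (0 : ℝ) ≤ ((2 ^ k * k : ℕ) : ℝ) ^ (2 * k + 1) := by positivity
  nlinarith

theorem card_sideSets_le {n k : ℕ} (V Z : Finset (Fin n)) (a : ℕ) :
    (Finset.univ.filter fun Y : Finset (Fin n) =>
      (Y.card = k ∧ Y ∩ V ⊆ Z) ∧ (Y ∩ V).card = a).card ≤ Z.card.choose a * n.choose (k - a) := by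
  have h : ((Finset.powersetCard a Z) ×ˢ
      (Finset.powersetCard (k - a) (Finset.univ : Finset (Fin n)))).card =
      Z.card.choose a * n.choose (k - a) := by simp
  rw [← h]
  refine Finset.card_le_card_of_injOn (fun Y => (Y ∩ V, Y \ V)) ?_ ?_
  · intro Y hY
    simp only [Finset.coe_filter, Finset.mem_univ, true_and, Set.mem_ofPred_eq] at hY
    obtain ⟨⟨h1, h2⟩, h3⟩ := hY
    have := Finset.card_inter_add_card_sdiff Y V
    simp only [Finset.coe_product, Set.mem_prod, Finset.mem_coe, Finset.mem_powersetCard,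
      Finset.subset_univ, true_and]
    exact ⟨⟨h2, h3⟩, by omega⟩
  · intro Y _ Y' _ hYY
    simp only [Prod.mk.injEq] at hYY
    rw [← Finset.sdiff_union_inter Y V, ← Finset.sdiff_union_inter Y' V, hYY.1, hYY.2]

theorem sum_sideSets_le {n k : ℕ} (V Z : Finset (Fin n)) {F : ℕ → ℝ} (hF : ∀ a, 0 ≤ F a) :
    ∑ Y : Finset (Fin n) with Y.card = k ∧ Y ∩ V ⊆ Z, F (Y ∩ V).card ≤
      ∑ a ∈ Finset.range (k + 1), (Z.card.choose a * n.choose (k - a) : ℕ) * F a := by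
  rw [← Finset.sum_fiberwise_of_maps_to (t := Finset.range (k + 1)) (g := fun Y => (Y ∩ V).card)]
  · refine Finset.sum_le_sum fun a _ => ?_
    rw [Finset.sum_congr rfl (g := fun _ => F a)
      (fun Y hY => by rw [(Finset.mem_filter.1 hY).2]), Finset.sum_const, nsmul_eq_mul,
      Finset.filter_filter]
    gcongr
    · exact hF a
    · exact card_sideSets_le V Z a
  · intro Y hY
    rw [Finset.mem_range, Nat.lt_succ_iff, ← (Finset.mem_filter.1 hY).2.1]
    exact Finset.card_le_card Finset.inter_subset_left

theorem sum_center_le {n : ℕ} (V : Finset (Fin n)) {F : ℕ → ℝ} (hF : ∀ e, 0 ≤ F e) :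
    ∑ z : Fin n, F (if z ∈ V then 1 else 0) ≤ n * F 0 + V.card * F 1 := by
  have h : ∀ z : Fin n, F (if z ∈ V then 1 else 0) ≤ F 0 + if z ∈ V then F 1 else 0 := by
    intro z
    split_ifs <;> linarith [hF 0]
  refine (Finset.sum_le_sum fun z _ => h z).trans (le_of_eq ?_)
  rw [Finset.sum_add_distrib, ← Finset.sum_filter]
  simp

/-- Sums over triples whose sides meet `V` only inside prescribed sets. -/
theorem sum_triples_le {n k m : ℕ} (V Z₁ Z₂ : Finset (Fin n)) (h₁ : Z₁.card = m)
    (h₂ : Z₂.card = m) {F : ℕ → ℕ → ℕ → ℝ} (hF : ∀ a b e, 0 ≤ F a b e) :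
    ∑ d ∈ (triples n k).filter (fun d => d.1 ∩ V ⊆ Z₁ ∧ d.2.1 ∩ V ⊆ Z₂),
        F (d.1 ∩ V).card (d.2.1 ∩ V).card (if d.2.2 ∈ V then 1 else 0) ≤
      ∑ a ∈ Finset.range (k + 1), (m.choose a * n.choose (k - a) : ℕ) *
        ∑ b ∈ Finset.range (k + 1), (m.choose b * n.choose (k - b) : ℕ) *
          (n * F a b 0 + V.card * F a b 1) := by
  have hsub : (triples n k).filter (fun d => d.1 ∩ V ⊆ Z₁ ∧ d.2.1 ∩ V ⊆ Z₂) ⊆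
      (Finset.univ.filter fun Y : Finset (Fin n) => Y.card = k ∧ Y ∩ V ⊆ Z₁) ×ˢ
      (Finset.univ.filter fun Y : Finset (Fin n) => Y.card = k ∧ Y ∩ V ⊆ Z₂) ×ˢ
      (Finset.univ : Finset (Fin n)) := by
    intro d hd
    obtain ⟨hd, h1, h2⟩ := Finset.mem_filter.1 hd
    obtain ⟨h3, h4, -⟩ := mem_triples.1 hd
    simp [h1, h2, h3, h4]
  refine (Finset.sum_le_sum_of_subset_of_nonneg hsub fun _ _ _ => hF _ _ _).trans ?_
  rw [Finset.sum_product]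
  subst h₁
  have hG : ∀ a b, 0 ≤ n * F a b 0 + V.card * F a b 1 := fun a b =>
    add_nonneg (mul_nonneg (by positivity) (hF _ _ _)) (mul_nonneg (by positivity) (hF _ _ _))
  refine le_trans (Finset.sum_le_sum fun Y₁ _ => ?_) (sum_sideSets_le V Z₁ (F := fun a =>
    ∑ b ∈ Finset.range (k + 1), (Z₁.card.choose b * n.choose (k - b) : ℕ) *
          (n * F a b 0 + V.card * F a b 1)) fun a => Finset.sum_nonneg fun b _ =>
            mul_nonneg (by positivity) (hG a b))
  rw [Finset.sum_product]
  rw [← h₂]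
  refine le_trans (Finset.sum_le_sum fun Y₂ _ => ?_) (sum_sideSets_le V Z₂ (F := fun b =>
    (n * F (Y₁ ∩ V).card b 0 + V.card * F (Y₁ ∩ V).card b 1)) fun b => hG _ b)
  exact sum_center_le V (F := F (Y₁ ∩ V).card (Y₂ ∩ V).card) fun e => hF _ _ e

/-- A bound for the probability that two triples sharing `t` vertices, where `1 ≤ t ≤ 2 * k`, are
both configurations. -/
noncomputable def pairBound (k t : ℕ) : ℝ :=
  if 1 ≤ t ∧ t ≤ 2 * k then
    (1 / 2) ^ (2 * (2 * k + 1).choose 2) * 2 ^ (t.choose 2) * domBound k t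
  else 0

theorem pairBound_nonneg (k t : ℕ) : 0 ≤ pairBound k t := by
  unfold pairBound
  split_ifs
  · have := domBound_pos k t
    positivity
  · exact le_rfl

theorem sum_expect_configInd_mul_le {k : ℕ}
    {c : Finset (Fin (2 ^ k * k)) × Finset (Fin (2 ^ k * k)) × Fin (2 ^ k * k)}
    (hc : c ∈ triples (2 ^ k * k) k) :
    ∑ d ∈ (triples (2 ^ k * k) k).filter
        (fun d => ((c.1 ∪ c.2.1) ∩ (d.1 ∪ d.2.1)).card ∈ Finset.Icc 1 (2 * k - 1)),
        expect (2 ^ k * k) (fun G => configInd c G * configInd d G) ≤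
      2 * ∑ a ∈ Finset.range (k + 1), ((k + 1).choose a * (2 ^ k * k).choose (k - a) : ℕ) *
        ∑ b ∈ Finset.range (k + 1), ((k + 1).choose b * (2 ^ k * k).choose (k - b) : ℕ) *
          ((2 ^ k * k : ℕ) * pairBound k (a + b + 0) +
            (2 * k + 1 : ℕ) * pairBound k (a + b + 1)) := by
  obtain ⟨hc1, hc2, -, hx1, hx2⟩ := mem_triples.1 hc
  have hF : ∀ a b e, 0 ≤ (fun a b e => pairBound k (a + b + e)) a b e :=
    fun a b e => pairBound_nonneg k _
  have hZ1 : (insert c.2.2 c.1).card = k + 1 := by rw [Finset.card_insert_of_notMem hx1, hc1]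
  have hZ2 : (insert c.2.2 c.2.1).card = k + 1 := by rw [Finset.card_insert_of_notMem hx2, hc2]
  have s1 := sum_triples_le (k := k) (vertexSet c) _ _ hZ1 hZ2 hF
  have s2 := sum_triples_le (k := k) (vertexSet c) _ _ hZ2 hZ1 hF
  rw [card_vertexSet hc] at s1 s2
  refine le_trans ?_ ((add_le_add s1 s2).trans_eq (two_mul _).symm)
  rw [Finset.sum_filter, Finset.sum_filter, Finset.sum_filter, ← Finset.sum_add_distrib]
  refine Finset.sum_le_sum fun d hd => ?_
  have e : (d.1 ∩ vertexSet c).card + (d.2.1 ∩ vertexSet c).card +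
      (if d.2.2 ∈ vertexSet c then 1 else 0) =
      (vertexSet c ∩ vertexSet d).card := (card_vertexSet_inter hd (vertexSet c)).symm
  rw [e]
  have h0 : 0 ≤ pairBound k (vertexSet c ∩ vertexSet d).card := pairBound_nonneg _ _
  have hnn : 0 ≤ (if d.1 ∩ vertexSet c ⊆ insert c.2.2 c.1 ∧
      d.2.1 ∩ vertexSet c ⊆ insert c.2.2 c.2.1 then
      pairBound k (vertexSet c ∩ vertexSet d).card else 0) +
      if d.1 ∩ vertexSet c ⊆ insert c.2.2 c.2.1 ∧ d.2.1 ∩ vertexSet c ⊆ insert c.2.2 c.1 then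
      pairBound k (vertexSet c ∩ vertexSet d).card else 0 := by
    split_ifs <;> linarith
  by_cases hJ : ((c.1 ∪ c.2.1) ∩ (d.1 ∪ d.2.1)).card ∈ Finset.Icc 1 (2 * k - 1)
  swap
  · rw [if_neg hJ]
    exact hnn
  rw [if_pos hJ]
  by_cases hG : ∃ G, IsConfig G c.1 c.2.1 c.2.2 ∧ IsConfig G d.1 d.2.1 d.2.2
  swap
  · refine le_trans (le_of_eq ?_) hnn
    have : (fun G => configInd c G * configInd d G) = fun _ => 0 := by
      ext G
      by_contra h
      refine hG ⟨G, ?_, ?_⟩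
      · by_contra h1
        exact h (by simp [configInd, h1])
      · by_contra h1
        exact h (by simp [configInd, h1])
    rw [this]
    simp [expect]
  obtain ⟨G, hcG, hdG⟩ := hG
  rw [Finset.mem_Icc] at hJ
  have hsub : (c.1 ∪ c.2.1) ∩ (d.1 ∪ d.2.1) ⊆ vertexSet c ∩ vertexSet d :=
    Finset.inter_subset_inter (Finset.subset_insert _ _) (Finset.subset_insert _ _)
  have ht1 : 1 ≤ (vertexSet c ∩ vertexSet d).card := hJ.1.trans (Finset.card_le_card hsub)
  have hne := hcG.vertexSet_ne hc hdG (by omega)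
  have ht2 : (vertexSet c ∩ vertexSet d).card ≤ 2 * k := by
    by_contra h
    have hcc := card_vertexSet hc
    have hdc := card_vertexSet hd
    have e1 : vertexSet c ∩ vertexSet d = vertexSet c :=
      Finset.eq_of_subset_of_card_le Finset.inter_subset_left (by omega)
    have e2 : vertexSet c ∩ vertexSet d = vertexSet d :=
      Finset.eq_of_subset_of_card_le Finset.inter_subset_right (by omega)
    exact hne (e1.symm.trans e2)
  have hle : expect (2 ^ k * k) (fun G => configInd c G * configInd d G) ≤
      pairBound k (vertexSet c ∩ vertexSet d).card := by
    unfold pairBound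
    rw [if_pos ⟨ht1, ht2⟩]
    exact expect_configInd_mul_le_domBound hc hd ht1
  rcases hcG.inter_subset hdG with h | h
  · rw [if_pos h]
    refine hle.trans (le_add_of_nonneg_right ?_)
    split_ifs <;> linarith
  · rw [if_pos h]
    refine hle.trans (le_add_of_nonneg_left ?_)
    split_ifs <;> linarith

/-! ### Estimates for the terms of the sum -/

theorem choose_mul_choose_mul_le {n k a : ℕ} (m : ℕ) (ha : a ≤ k) :
    m.choose a * n.choose (k - a) * n ^ a * k.factorial ≤
      m.choose a * k.descFactorial a * n ^ k := by
  have h1 : (k - a).factorial * n.choose (k - a) ≤ n ^ (k - a) := by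
    rw [← Nat.descFactorial_eq_factorial_mul_choose]
    exact Nat.descFactorial_le_pow _ _
  calc m.choose a * n.choose (k - a) * n ^ a * k.factorial
      = m.choose a * k.descFactorial a * (n ^ a * ((k - a).factorial * n.choose (k - a))) := by
        rw [← Nat.factorial_mul_descFactorial ha]
        ring
    _ ≤ m.choose a * k.descFactorial a * (n ^ a * n ^ (k - a)) := by gcongr
    _ = m.choose a * k.descFactorial a * n ^ k := by rw [← pow_add, Nat.add_sub_cancel' ha]

theorem choose_mul_descFactorial_le_pow (k a : ℕ) :
    (k + 1).choose a * k.descFactorial a ≤ ((k + 1) * k) ^ a := by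
  rw [mul_pow]
  exact Nat.mul_le_mul (Nat.choose_le_pow _ _) (Nat.descFactorial_le_pow _ _)

theorem choose_mul_descFactorial_le_factorial {k a : ℕ} (ha : a ≤ k) :
    (k + 1).choose a * k.descFactorial a ≤ (k + 1) ^ (k + 1 - a) * k.factorial := by
  refine Nat.mul_le_mul ?_ ?_
  · rw [← Nat.choose_symm (by omega)]
    exact Nat.choose_le_pow _ _
  · rw [← Nat.factorial_mul_descFactorial ha]
    exact Nat.le_mul_of_pos_left _ (Nat.factorial_pos _)

theorem factorial_mul_exp_le {k : ℕ} (hk : 1 ≤ k) :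
    (k.factorial : ℝ) * exp k ≤ exp 1 * k * (k : ℝ) ^ k := by
  induction k, hk using Nat.le_induction with
  | base => simp
  | succ k hk ih =>
    have hk0 : (0 : ℝ) < k + 1 := by positivity
    have h1 : exp 1 * (k : ℝ) ^ (k + 1) ≤ ((k : ℝ) + 1) ^ (k + 1) := by
      have h2 : (k : ℝ) / (k + 1) ≤ exp (-(1 / (k + 1))) := by
        refine le_trans (le_of_eq ?_) (add_one_le_exp _)
        field_simp
        ring
      have h3 : ((k : ℝ) / (k + 1)) ^ (k + 1) ≤ exp (-1) := by
        calc ((k : ℝ) / (k + 1)) ^ (k + 1) ≤ exp (-(1 / (k + 1))) ^ (k + 1) := by gcongr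
          _ = exp (-1) := by
            rw [← exp_nat_mul]
            congr 1
            push_cast
            field_simp
      rw [div_pow, div_le_iff₀ (by positivity)] at h3
      calc exp 1 * (k : ℝ) ^ (k + 1) ≤ exp 1 * (exp (-1) * ((k : ℝ) + 1) ^ (k + 1)) := by gcongr
        _ = ((k : ℝ) + 1) ^ (k + 1) := by rw [← mul_assoc, ← exp_add]; simp
    rw [Nat.factorial_succ]
    push_cast
    rw [exp_add]
    calc ((k : ℝ) + 1) * k.factorial * (exp k * exp 1)
        = ((k : ℝ) + 1) * exp 1 * (k.factorial * exp k) := by ring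
      _ ≤ ((k : ℝ) + 1) * exp 1 * (exp 1 * k * (k : ℝ) ^ k) := by gcongr
      _ = exp 1 * ((k : ℝ) + 1) * (exp 1 * (k : ℝ) ^ (k + 1)) := by ring
      _ ≤ exp 1 * ((k : ℝ) + 1) * ((k : ℝ) + 1) ^ (k + 1) := by gcongr

theorem choose_two_mul_two (t : ℕ) : t.choose 2 * 2 = t * (t - 1) := by
  rw [Nat.choose_two_right, Nat.div_mul_cancel (Nat.even_mul_pred_self t).two_dvd]

/-- With `r = 2 ^ (-k / 2)`, a bound for `2 ^ (t.choose 2)` in terms of `2 ^ (k * t)`. -/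
theorem two_pow_choose_two_le {k t s : ℕ} {r : ℝ} (hr : 0 ≤ r) (hr2 : r ^ 2 * 2 ^ k = 1)
    (h : t * (t - 1) + k * s ≤ 2 * (k * t)) : (2 : ℝ) ^ (t.choose 2) ≤ 2 ^ (k * t) * r ^ s := by
  refine le_of_sq_le_sq ?_ (by positivity)
  have e : (r ^ s) ^ 2 * 2 ^ (k * s) = 1 := by
    rw [← pow_mul, mul_comm s 2, pow_mul, pow_mul, ← mul_pow, hr2, one_pow]
  calc ((2 : ℝ) ^ (t.choose 2)) ^ 2 = 2 ^ (t * (t - 1)) * ((r ^ s) ^ 2 * 2 ^ (k * s)) := by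
        rw [← pow_mul, choose_two_mul_two, e, mul_one]
    _ = 2 ^ (t * (t - 1) + k * s) * (r ^ s) ^ 2 := by rw [pow_add]; ring
    _ ≤ 2 ^ (2 * (k * t)) * (r ^ s) ^ 2 := by
        gcongr
        norm_num
    _ = (2 ^ (k * t) * r ^ s) ^ 2 := by rw [mul_pow, mul_comm 2 (k * t), pow_mul]

theorem weight_le_of_le {k a b e : ℕ} {r : ℝ} (hk : 1 ≤ k) (hr : 0 ≤ r)
    (hr2 : r ^ 2 * 2 ^ k = 1) (hsmall : 3 * (k + 1) * exp 6 * r ≤ 1)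
    (ht1 : 1 ≤ a + b + e) (ht : a + b + e ≤ k) :
    (((k + 1).choose a * k.descFactorial a : ℕ) : ℝ) *
        (((k + 1).choose b * k.descFactorial b : ℕ) : ℝ) * (2 * k + 1) ^ e *
        2 ^ ((a + b + e).choose 2) * domBound k (a + b + e) * exp (4 * k) ≤
      3 * exp 30 * (k + 1) * r * (2 ^ k * k) ^ (a + b + e) := by
  have hk' : (1 : ℝ) ≤ k := by exact_mod_cast hk
  have h1 : ∀ a, (((k + 1).choose a * k.descFactorial a : ℕ) : ℝ) ≤ (3 * (k + 1) * k) ^ a := by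
    intro a
    have : (((k + 1).choose a * k.descFactorial a : ℕ) : ℝ) ≤ (((k + 1) * k) ^ a : ℕ) := by
      exact_mod_cast choose_mul_descFactorial_le_pow k a
    refine this.trans ?_
    push_cast
    gcongr
    linarith
  have h2 : (2 * k + 1 : ℝ) ^ e ≤ (3 * (k + 1) * k) ^ e := by
    gcongr
    nlinarith
  have h3 : (2 : ℝ) ^ ((a + b + e).choose 2) ≤ 2 ^ (k * (a + b + e)) * r ^ (a + b + e) := by
    refine two_pow_choose_two_le hr hr2 ?_
    have : (a + b + e) * (a + b + e - 1) ≤ (a + b + e) * k := Nat.mul_le_mul_left _ (by omega)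
    linarith
  have h4 : domBound k (a + b + e) * exp (4 * k) = exp 24 * exp 6 ^ (a + b + e) := by
    rw [domBound, if_pos ht, ← exp_add, ← exp_nat_mul, ← exp_add]
    congr 1
    ring
  rw [mul_assoc _ (domBound _ _), h4]
  calc _ ≤ (3 * (k + 1) * k : ℝ) ^ a * (3 * (k + 1) * k) ^ b * (3 * (k + 1) * k) ^ e *
        (2 ^ (k * (a + b + e)) * r ^ (a + b + e)) * (exp 24 * exp 6 ^ (a + b + e)) := by
        gcongr
        · exact h1 a
        · exact h1 b
    _ = exp 24 * (3 * (k + 1) * exp 6 * r) ^ (a + b + e) * (2 ^ k * k) ^ (a + b + e) := by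
        rw [pow_mul]
        simp only [mul_pow, pow_add]
        ring
    _ ≤ exp 24 * (3 * (k + 1) * exp 6 * r) * (2 ^ k * k) ^ (a + b + e) := by
        gcongr
        exact pow_le_of_le_one (by positivity) hsmall (by omega)
    _ = 3 * exp 30 * (k + 1) * r * (2 ^ k * k) ^ (a + b + e) := by
        rw [show (30 : ℝ) = 24 + 6 by norm_num, exp_add]
        ring

theorem weight_le_of_lt {k a b e : ℕ} {r : ℝ} (hk : 1 ≤ k) (ha : a ≤ k) (hb : b ≤ k) (he : e ≤ 1)
    (hr : 0 ≤ r) (hr2 : r ^ 2 * 2 ^ k = 1) (hsmall : (k + 1) ^ 2 * r ≤ 1)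
    (ht1 : k < a + b + e) (ht : a + b + e ≤ 2 * k) :
    (((k + 1).choose a * k.descFactorial a : ℕ) : ℝ) *
        (((k + 1).choose b * k.descFactorial b : ℕ) : ℝ) * (2 * k + 1) ^ e *
        2 ^ ((a + b + e).choose 2) * domBound k (a + b + e) * exp (4 * k) ≤
      2 * exp 15 * (k + 1) ^ 6 * r * (2 ^ k * k) ^ (a + b + e) := by
  have hk' : (1 : ℝ) ≤ k := by exact_mod_cast hk
  obtain ⟨s, hs⟩ := Nat.exists_eq_add_of_le (show a + b + e ≤ 2 * k + 1 by omega)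
  have hs1 : 1 ≤ s := by omega
  have h1 : ∀ a ≤ k, (((k + 1).choose a * k.descFactorial a : ℕ) : ℝ) ≤
      (k + 1) ^ (k + 1 - a) * k.factorial := by
    intro a ha
    exact_mod_cast choose_mul_descFactorial_le_factorial ha
  have h2 : (2 * k + 1 : ℝ) ^ e ≤ 2 * (k + 1) := by
    refine (pow_le_pow_right₀ (by linarith) he).trans ?_
    linarith
  have h3 : (2 : ℝ) ^ ((a + b + e).choose 2) ≤ 2 ^ (k * (a + b + e)) * r ^ s := by
    refine two_pow_choose_two_le hr hr2 ?_
    have e1 : a + b + e - 1 + s = 2 * k := by omega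
    have e2 : (a + b + e) * (a + b + e - 1) + (a + b + e) * s = 2 * (k * (a + b + e)) := by
      rw [← mul_add, e1]
      ring
    have : k * s ≤ (a + b + e) * s := Nat.mul_le_mul_right _ ht1.le
    omega
  have h4 : domBound k (a + b + e) * exp (4 * k) = exp 13 * exp k ^ 2 := by
    rw [domBound, if_neg (by omega), ← exp_add, ← exp_nat_mul, ← exp_add]
    congr 1
    push_cast
    ring
  have h5 : (k + 1 : ℝ) ^ (k + 1 - a) * (k + 1) ^ (k + 1 - b) ≤ (k + 1) ^ (s + 2) := by
    rw [← pow_add]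
    exact pow_le_pow_right₀ (by linarith) (by omega)
  rw [mul_assoc _ (domBound _ _), h4]
  calc _ ≤ ((k + 1 : ℝ) ^ (k + 1 - a) * k.factorial) * ((k + 1 : ℝ) ^ (k + 1 - b) * k.factorial) *
        (2 * (k + 1)) * (2 ^ (k * (a + b + e)) * r ^ s) * (exp 13 * exp k ^ 2) := by
        gcongr
        · exact h1 a ha
        · exact h1 b hb
    _ = ((k + 1 : ℝ) ^ (k + 1 - a) * (k + 1 : ℝ) ^ (k + 1 - b)) * (k.factorial * exp k) ^ 2 *
        (2 * (k + 1)) * (2 ^ (k * (a + b + e)) * r ^ s) * exp 13 := by ring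
    _ ≤ (k + 1) ^ (s + 2) * (exp 1 * k * (k : ℝ) ^ k) ^ 2 *
        (2 * (k + 1)) * (2 ^ (k * (a + b + e)) * r ^ s) * exp 13 := by
        gcongr ?_ * ?_ * _ * _ * _
        exact pow_le_pow_left₀ (by positivity) (factorial_mul_exp_le hk) 2
    _ = 2 * (exp 13 * exp 1 ^ 2) * ((k + 1) ^ (s + 3) * r ^ s) * (k : ℝ) ^ (s + 1) *
        (2 ^ k * k) ^ (a + b + e) := by
        have : (k * (k : ℝ) ^ k) ^ 2 = (k : ℝ) ^ (s + 1) * (k : ℝ) ^ (a + b + e) := by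
          rw [← pow_succ', ← pow_mul, ← pow_add]
          congr 1
          omega
        rw [mul_assoc (exp 1), mul_pow (exp 1), this, mul_pow _ (k : ℝ), ← pow_mul]
        ring
    _ ≤ 2 * (exp 13 * exp 1 ^ 2) * ((k + 1) ^ (s + 3) * r ^ s) * (k + 1 : ℝ) ^ (s + 1) *
        (2 ^ k * k) ^ (a + b + e) := by
        gcongr
        linarith
    _ = 2 * exp 15 * (k + 1) ^ 4 * ((k + 1) ^ 2 * r) ^ s * (2 ^ k * k) ^ (a + b + e) := by
        have e15 : exp 13 * exp 1 ^ 2 = exp 15 := by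
          rw [← exp_nat_mul, ← exp_add]
          norm_num
        rw [e15, mul_pow _ r, ← pow_mul]
        ring
    _ ≤ 2 * exp 15 * (k + 1) ^ 4 * ((k + 1) ^ 2 * r) * (2 ^ k * k) ^ (a + b + e) := by
        gcongr
        exact pow_le_of_le_one (by positivity) hsmall (by omega)
    _ = 2 * exp 15 * (k + 1) ^ 6 * r * (2 ^ k * k) ^ (a + b + e) := by ring

theorem weight_le {k a b e : ℕ} {r : ℝ} (hk : 1 ≤ k) (ha : a ≤ k) (hb : b ≤ k) (he : e ≤ 1)
    (hr : 0 ≤ r) (hr2 : r ^ 2 * 2 ^ k = 1) (hsmall₁ : 3 * (k + 1) * exp 6 * r ≤ 1)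
    (hsmall₂ : (k + 1) ^ 2 * r ≤ 1) (ht1 : 1 ≤ a + b + e) (ht : a + b + e ≤ 2 * k) :
    (((k + 1).choose a * k.descFactorial a : ℕ) : ℝ) *
        (((k + 1).choose b * k.descFactorial b : ℕ) : ℝ) * (2 * k + 1) ^ e *
        2 ^ ((a + b + e).choose 2) * domBound k (a + b + e) * exp (4 * k) ≤
      3 * exp 30 * (k + 1) ^ 6 * r * (2 ^ k * k) ^ (a + b + e) := by
  have hk0 : (0 : ℝ) ≤ k := by positivity
  rcases le_or_gt (a + b + e) k with h | h
  · refine (weight_le_of_le hk hr hr2 hsmall₁ ht1 h).trans ?_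
    gcongr
    exact le_self_pow₀ (by linarith) (by norm_num)
  · refine (weight_le_of_lt hk ha hb he hr hr2 hsmall₂ h ht).trans ?_
    gcongr <;> norm_num

theorem term_le {k a b e : ℕ} {r M : ℝ} (hk : 4 * (2 * k + 1) ≤ 2 ^ k) (ha : a ≤ k) (hb : b ≤ k)
    (he : e ≤ 1) (hr : 0 ≤ r) (hr2 : r ^ 2 * 2 ^ k = 1) (hsmall₁ : 3 * (k + 1) * exp 6 * r ≤ 1)
    (hsmall₂ : (k + 1) ^ 2 * r ≤ 1) (hM0 : 0 ≤ M)
    (hM : M * (2 ^ k * k) ^ e = 2 ^ k * k * (2 * k + 1) ^ e) :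
    ((k + 1).choose a * (2 ^ k * k).choose (k - a) : ℕ) *
        (((k + 1).choose b * (2 ^ k * k).choose (k - b) : ℕ) *
          (M * pairBound k (a + b + e))) * exp (4 * k) ≤
      6 * exp 30 * (k + 1) ^ 6 * r * (1 / 2) ^ (2 * (2 * k + 1).choose 2) *
        (triples (2 ^ k * k) k).card := by
  unfold pairBound
  split_ifs with h
  swap
  · rw [mul_zero, mul_zero, mul_zero, zero_mul]
    positivity
  obtain ⟨ht1, ht2⟩ := h
  have hk1 : 1 ≤ k := by
    rcases Nat.eq_zero_or_pos k with rfl | h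
    · norm_num at hk
    · exact h
  have hW := weight_le hk1 ha hb he hr hr2 hsmall₁ hsmall₂ ht1 ht2
  have hN := le_two_mul_card_triples hk
  have hB : ∀ a ≤ k, (((k + 1).choose a * (2 ^ k * k).choose (k - a) : ℕ) : ℝ) *
      ((2 ^ k * k) ^ a * k.factorial) ≤
      (((k + 1).choose a * k.descFactorial a : ℕ) : ℝ) * (2 ^ k * k) ^ k := by
    intro a ha
    have h1 := choose_mul_choose_mul_le (n := 2 ^ k * k) (k + 1) ha
    have h2 : (((k + 1).choose a * (2 ^ k * k).choose (k - a) * (2 ^ k * k) ^ a * k.factorial : ℕ) :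
      ℝ) ≤ ((k + 1).choose a * k.descFactorial a * (2 ^ k * k) ^ k : ℕ) := by exact_mod_cast h1
    push_cast at h2 ⊢
    linarith
  have hBa := hB a ha
  have hBb := hB b hb
  push_cast at hN
  set Ba := (((k + 1).choose a * (2 ^ k * k).choose (k - a) : ℕ) : ℝ)
  set Bb := (((k + 1).choose b * (2 ^ k * k).choose (k - b) : ℕ) : ℝ)
  set wa := (((k + 1).choose a * k.descFactorial a : ℕ) : ℝ)
  set wb := (((k + 1).choose b * k.descFactorial b : ℕ) : ℝ)
  set N := ((triples (2 ^ k * k) k).card : ℝ)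
  set n : ℝ := 2 ^ k * k with hn
  set f : ℝ := (k.factorial : ℝ)
  set Q : ℝ := (1 / 2) ^ (2 * (2 * k + 1).choose 2) with hQ
  have hQ0 : 0 < Q := by positivity
  have hf : 0 < f := by positivity
  have hkr : (0 : ℝ) < k := by exact_mod_cast hk1
  have hn0 : 0 < n := by positivity
  have hwa : 0 ≤ wa := by positivity
  have hwb : 0 ≤ wb := by positivity
  have hD := domBound_pos k (a + b + e)
  have h1 : Ba * Bb * M * n ^ (a + b + e) ≤ 2 * N * (wa * wb * (2 * k + 1) ^ e) := by
    refine le_of_mul_le_mul_right ?_ (by positivity : 0 < f ^ 2)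
    calc Ba * Bb * M * n ^ (a + b + e) * f ^ 2
        = (Ba * (n ^ a * f)) * (Bb * (n ^ b * f)) * (M * n ^ e) := by
          rw [pow_add, pow_add]
          ring
      _ ≤ (wa * n ^ k) * (wb * n ^ k) * (M * n ^ e) := by gcongr
      _ = wa * wb * (2 * k + 1) ^ e * n ^ (2 * k + 1) := by
          rw [hM]
          ring
      _ ≤ wa * wb * (2 * k + 1) ^ e * (2 * (f ^ 2 * N)) := by gcongr
      _ = 2 * N * (wa * wb * (2 * k + 1) ^ e) * f ^ 2 := by ring
  refine le_of_mul_le_mul_right ?_ (by positivity : 0 < n ^ (a + b + e))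
  calc Ba * (Bb * (M * (Q * 2 ^ ((a + b + e).choose 2) * domBound k (a + b + e)))) * exp (4 * k) *
        n ^ (a + b + e)
      = Q * ((Ba * Bb * M * n ^ (a + b + e)) *
          (2 ^ ((a + b + e).choose 2) * domBound k (a + b + e) * exp (4 * k))) := by ring
    _ ≤ Q * ((2 * N * (wa * wb * (2 * k + 1) ^ e)) *
          (2 ^ ((a + b + e).choose 2) * domBound k (a + b + e) * exp (4 * k))) := by gcongr
    _ = 2 * N * Q * (wa * wb * (2 * k + 1) ^ e * 2 ^ ((a + b + e).choose 2) *
          domBound k (a + b + e) * exp (4 * k)) := by ring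
    _ ≤ 2 * N * Q * (3 * exp 30 * (k + 1) ^ 6 * r * n ^ (a + b + e)) := by gcongr
    _ = 6 * exp 30 * (k + 1) ^ 6 * r * Q * N * n ^ (a + b + e) := by ring

theorem sum_expect_configInd_mul_le_card {k : ℕ} {r : ℝ} (hk : 4 * (2 * k + 1) ≤ 2 ^ k)
    (hr : 0 ≤ r) (hr2 : r ^ 2 * 2 ^ k = 1) (hsmall₁ : 3 * (k + 1) * exp 6 * r ≤ 1)
    (hsmall₂ : (k + 1) ^ 2 * r ≤ 1)
    {c : Finset (Fin (2 ^ k * k)) × Finset (Fin (2 ^ k * k)) × Fin (2 ^ k * k)}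
    (hc : c ∈ triples (2 ^ k * k) k) :
    (∑ d ∈ (triples (2 ^ k * k) k).filter
        (fun d => ((c.1 ∪ c.2.1) ∩ (d.1 ∪ d.2.1)).card ∈ Finset.Icc 1 (2 * k - 1)),
        expect (2 ^ k * k) (fun G => configInd c G * configInd d G)) * exp (4 * k) ≤
      24 * exp 30 * (k + 1) ^ 8 * r * (1 / 2) ^ (2 * (2 * k + 1).choose 2) *
        (triples (2 ^ k * k) k).card := by
  set R := 6 * exp 30 * (k + 1) ^ 6 * r * (1 / 2) ^ (2 * (2 * k + 1).choose 2) *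
        (triples (2 ^ k * k) k).card with hR
  refine (mul_le_mul_of_nonneg_right (sum_expect_configInd_mul_le hc) (exp_pos _).le).trans ?_
  calc _ = 2 * ∑ a ∈ Finset.range (k + 1), ∑ b ∈ Finset.range (k + 1),
        (((k + 1).choose a * (2 ^ k * k).choose (k - a) : ℕ) *
          (((k + 1).choose b * (2 ^ k * k).choose (k - b) : ℕ) *
          ((2 ^ k * k : ℝ) * pairBound k (a + b + 0))) * exp (4 * k) +
        ((k + 1).choose a * (2 ^ k * k).choose (k - a) : ℕ) *
          (((k + 1).choose b * (2 ^ k * k).choose (k - b) : ℕ) *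
          ((2 * k + 1 : ℝ) * pairBound k (a + b + 1))) * exp (4 * k)) := by
        rw [mul_assoc, Finset.sum_mul]
        congr 1
        refine Finset.sum_congr rfl fun a _ => ?_
        rw [Finset.mul_sum, Finset.sum_mul]
        refine Finset.sum_congr rfl fun b _ => ?_
        push_cast
        ring
    _ ≤ 2 * ∑ a ∈ Finset.range (k + 1), ∑ b ∈ Finset.range (k + 1), (R + R) := by
        gcongr with a ha b hb
        · refine term_le hk ?_ ?_ (by norm_num) hr hr2 hsmall₁ hsmall₂ (by positivity) (by simp)
          · exact Nat.lt_succ_iff.1 (Finset.mem_range.1 ha)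
          · exact Nat.lt_succ_iff.1 (Finset.mem_range.1 hb)
        · refine term_le hk ?_ ?_ le_rfl hr hr2 hsmall₁ hsmall₂ (by positivity)
            (by rw [pow_one, pow_one, mul_comm])
          · exact Nat.lt_succ_iff.1 (Finset.mem_range.1 ha)
          · exact Nat.lt_succ_iff.1 (Finset.mem_range.1 hb)
    _ = _ := by
        simp only [Finset.sum_const, Finset.card_range, nsmul_eq_mul, hR]
        push_cast
        ring

/-! ### Moments of the number of configurations -/

theorem IsConfig.mem_triples {n k : ℕ} {G : SimpleGraph (Fin n)}
    {c : Finset (Fin n) × Finset (Fin n) × Fin n} (h : IsConfig G c.1 c.2.1 c.2.2)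
    (h1 : c.1.card = k) (h2 : c.2.1.card = k) : c ∈ triples n k :=
  _root_.mem_triples.2 ⟨h1, h2, h.2.2.1, h.2.2.2.1, h.2.2.2.2.1⟩

theorem Xcount_eq_sum {n k : ℕ} (G : SimpleGraph (Fin n)) :
    (Xcount n k k G : ℝ) = ∑ c ∈ triples n k, configInd c G := by
  classical
  simp only [configInd]
  rw [Finset.sum_boole, Xcount, Nat.card_eq_fintype_card, Fintype.card_subtype]
  congr 2
  ext c
  simp only [Finset.mem_filter, Finset.mem_univ, true_and]
  exact ⟨fun h => ⟨h.2.2.mem_triples h.1 h.2.1, h.2.2⟩,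
    fun h => ⟨(mem_triples.1 h.1).1, (mem_triples.1 h.1).2.1, h.2⟩⟩

theorem sum_PairCount_eq {n k : ℕ} (s : Finset ℕ) (G : SimpleGraph (Fin n)) :
    ∑ j ∈ s, (PairCount n k j G : ℝ) =
      ∑ c ∈ triples n k, ∑ d ∈ (triples n k).filter
        (fun d => ((c.1 ∪ c.2.1) ∩ (d.1 ∪ d.2.1)).card ∈ s), configInd c G * configInd d G := by
  classical
  have h : ∀ j, (PairCount n k j G : ℝ) = ∑ c ∈ triples n k, ∑ d ∈ triples n k,
      if ((c.1 ∪ c.2.1) ∩ (d.1 ∪ d.2.1)).card = j then configInd c G * configInd d G else 0 := by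
    intro j
    rw [← Finset.sum_product']
    simp only [configInd, mul_ite, mul_one, mul_zero, ← ite_and]
    rw [Finset.sum_boole, PairCount, Nat.card_eq_fintype_card, Fintype.card_subtype]
    congr 2
    ext ⟨c, d⟩
    simp only [Finset.mem_filter, Finset.mem_univ, true_and, Finset.mem_product]
    constructor
    · rintro ⟨⟨h1, h2, h3⟩, ⟨h4, h5, h6⟩, h7⟩
      exact ⟨⟨h3.mem_triples h1 h2, h6.mem_triples h4 h5⟩, h7, h6, h3⟩
    · rintro ⟨⟨h1, h2⟩, h7, h6, h3⟩
      exact ⟨⟨(mem_triples.1 h1).1, (mem_triples.1 h1).2.1, h3⟩,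
        ⟨(mem_triples.1 h2).1, (mem_triples.1 h2).2.1, h6⟩, h7⟩
  simp only [h]
  rw [Finset.sum_comm]
  refine Finset.sum_congr rfl fun c _ => ?_
  rw [Finset.sum_comm, Finset.sum_filter]
  refine Finset.sum_congr rfl fun d _ => ?_
  rw [Finset.sum_ite_eq]

theorem sum_A_eq {n k : ℕ} (s : Finset ℕ) :
    ∑ j ∈ s, A n k j = (∑ c ∈ triples n k, ∑ d ∈ (triples n k).filter
        (fun d => ((c.1 ∪ c.2.1) ∩ (d.1 ∪ d.2.1)).card ∈ s),
          expect n (fun G => configInd c G * configInd d G)) / 4 := by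
  simp only [A]
  rw [← Finset.sum_div, ← expect_sum]
  simp only [sum_PairCount_eq, expect_sum]

theorem le_expect_Xcount {k : ℕ} (hk : 0 < k) :
    (triples (2 ^ k * k) k).card * ((1 / 2 : ℝ) ^ (2 * k + 1).choose 2 * exp (-2 * k - 2)) / 2 ≤
      expect (2 ^ k * k) (fun G => (Xcount (2 ^ k * k) k k G : ℝ) / 2) := by
  rw [expect_div_const]
  simp only [Xcount_eq_sum]
  rw [expect_sum, ← nsmul_eq_mul]
  gcongr
  refine Finset.card_nsmul_le_sum _ _ _ fun c hc => ?_
  refine le_trans ?_ (le_expect_configInd hk hc)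
  gcongr
  exact exp_le_one_sub_half_pow hk (Nat.sub_le _ _)

theorem sum_A_le {k : ℕ} {r : ℝ} (hk : 4 * (2 * k + 1) ≤ 2 ^ k)
    (hr : 0 ≤ r) (hr2 : r ^ 2 * 2 ^ k = 1) (hsmall₁ : 3 * (k + 1) * exp 6 * r ≤ 1)
    (hsmall₂ : (k + 1) ^ 2 * r ≤ 1) :
    ∑ j ∈ Finset.Icc 1 (2 * k - 1), A (2 ^ k * k) k j ≤
      24 * exp 34 * (k + 1) ^ 8 * r *
        (expect (2 ^ k * k) (fun G => (Xcount (2 ^ k * k) k k G : ℝ) / 2)) ^ 2 := by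
  have hk1 : 0 < k := by
    rcases Nat.eq_zero_or_pos k with rfl | h
    · norm_num at hk
    · exact h
  rw [sum_A_eq]
  set N := ((triples (2 ^ k * k) k).card : ℝ) with hN
  set Q := (1 / 2 : ℝ) ^ (2 * k + 1).choose 2 with hQ
  have hX : (N * (Q * exp (-2 * k - 2)) / 2) ^ 2 ≤
      (expect (2 ^ k * k) (fun G => (Xcount (2 ^ k * k) k k G : ℝ) / 2)) ^ 2 :=
    pow_le_pow_left₀ (by positivity) (le_expect_Xcount hk1) 2
  have hS : (∑ c ∈ triples (2 ^ k * k) k, ∑ d ∈ (triples (2 ^ k * k) k).filter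
        (fun d => ((c.1 ∪ c.2.1) ∩ (d.1 ∪ d.2.1)).card ∈ Finset.Icc 1 (2 * k - 1)),
          expect (2 ^ k * k) (fun G => configInd c G * configInd d G)) * exp (4 * k) ≤
      N * (24 * exp 30 * (k + 1) ^ 8 * r * Q ^ 2 * N) := by
    rw [Finset.sum_mul, hN, ← nsmul_eq_mul]
    refine Finset.sum_le_card_nsmul _ _ _ fun c hc => ?_
    rw [hQ, ← pow_mul, mul_comm _ 2]
    exact sum_expect_configInd_mul_le_card hk hr hr2 hsmall₁ hsmall₂ hc
  rw [← le_div_iff₀ (exp_pos _)] at hS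
  calc _ ≤ N * (24 * exp 30 * (k + 1) ^ 8 * r * Q ^ 2 * N) / exp (4 * k) / 4 := by gcongr
    _ = 24 * exp 34 * (k + 1) ^ 8 * r * (N * (Q * exp (-2 * k - 2)) / 2) ^ 2 := by
        have e1 : exp (-2 * k - 2) ^ 2 * (exp (4 * k) * exp 4) = 1 := by
          rw [← exp_nat_mul, ← exp_add, ← exp_add, exp_eq_one_iff]
          push_cast
          ring
        have e2 : exp 34 = exp 30 * exp 4 := by
          rw [← exp_add]
          norm_num
        rw [e2, div_div, div_eq_iff (by positivity)]
        linear_combination (-(24 * exp 30 * (k + 1) ^ 8 * r * Q ^ 2 * N ^ 2)) * e1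
    _ ≤ _ := by gcongr

theorem tendsto_pow_mul_sqrt_half_pow (m : ℕ) :
    Tendsto (fun k : ℕ => ((k : ℝ) + 1) ^ m * (√(1 / 2)) ^ k) atTop (nhds 0) := by
  have hpos : 0 < √(1 / 2 : ℝ) := by positivity
  have hlt : √(1 / 2 : ℝ) < 1 := by
    rw [Real.sqrt_lt' one_pos]
    norm_num
  have h := (tendsto_pow_const_mul_const_pow_of_lt_one m hpos.le hlt).comp (tendsto_add_atTop_nat 1)
  have h2 := h.mul_const (√(1 / 2 : ℝ))⁻¹
  rw [zero_mul] at h2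
  refine h2.congr fun k => ?_
  simp only [Function.comp_apply]
  push_cast
  rw [pow_succ]
  field_simp

/-- With `n_k = 2^k k`,
`Σ_{j=1}^{2k−1} A_j = o((E X̃(k,k))²)` as `k → ∞`. -/
theorem sum_A_isLittleO :
    (fun k : ℕ => ∑ j ∈ Finset.Icc 1 (2 * k - 1), A (2 ^ k * k) k j)
      =o[atTop] (fun k : ℕ =>
        (expect (2 ^ k * k) (fun G => (Xcount (2 ^ k * k) k k G : ℝ) / 2)) ^ 2) := by
  rw [Asymptotics.isLittleO_iff]
  intro ε hε
  have hη := (tendsto_pow_mul_sqrt_half_pow 8).const_mul (24 * exp 34)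
  have h1 := (tendsto_pow_mul_sqrt_half_pow 1).const_mul (3 * exp 6)
  have h2 := tendsto_pow_mul_sqrt_half_pow 2
  have h3 : Tendsto (fun k : ℕ => (12 : ℝ) * (((k : ℝ) + 1) ^ 1 * (√(1 / 2)) ^ k)) atTop
      (nhds (12 * 0)) := (tendsto_pow_mul_sqrt_half_pow 1).const_mul 12
  rw [mul_zero] at hη h1 h3
  filter_upwards [hη.eventually_le_const hε, h1.eventually_le_const one_pos,
    h2.eventually_le_const one_pos, h3.eventually_le_const one_pos] with k hη h1 h2 h3
  have hr : (0 : ℝ) ≤ √(1 / 2) ^ k := by positivity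
  have hr2 : (√(1 / 2) ^ k) ^ 2 * (2 : ℝ) ^ k = 1 := by
    rw [← pow_mul, mul_comm k 2, pow_mul, Real.sq_sqrt (by norm_num), half_pow_mul_two_pow]
  have hr1 : √(1 / 2 : ℝ) ^ k ≤ 1 := pow_le_one₀ (by positivity) (Real.sqrt_le_one.2 (by norm_num))
  rw [pow_one] at h1 h3
  have hk : 4 * (2 * k + 1) ≤ 2 ^ k := by
    have : (4 * (2 * k + 1) : ℝ) ≤ 2 ^ k := by
      have hk0 : (0 : ℝ) ≤ k := by positivity
      have h4 : 12 * ((k : ℝ) + 1) * ((√(1 / 2) ^ k) ^ 2 * 2 ^ k) ≤ 1 * 2 ^ k := by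
        have h5 : 12 * ((k : ℝ) + 1) * (√(1 / 2) ^ k) ^ 2 ≤ 1 := by
          have : 12 * ((k : ℝ) + 1) * (√(1 / 2) ^ k) ^ 2 =
            (12 * (((k : ℝ) + 1) * √(1 / 2) ^ k)) * √(1 / 2) ^ k := by ring
          rw [this]
          exact mul_le_one₀ h3 hr hr1
        rw [← mul_assoc]
        gcongr
      rw [hr2] at h4
      linarith
    exact_mod_cast this
  rw [Real.norm_of_nonneg (sq_nonneg _), Real.norm_of_nonneg]
  · refine (sum_A_le hk hr hr2 (le_trans (le_of_eq (by ring)) h1) h2).trans ?_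
    gcongr
    exact le_trans (le_of_eq (by ring)) hη
  · refine Finset.sum_nonneg fun j _ => div_nonneg (expect_nonneg fun G => ?_) (by norm_num)
    positivity
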